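/- arXiv:1706.08290 — 2 statements merged into one kernel-verified Lean document; each statement's English description precedes it below -/
import Mathlib

section
/- Let N be a normal subgroup of prime order p in a finite group G. Assume that N = C_G(N) and that G/N is cyclic of order m with m coprime to p. Then β(G) ≤ p · m^{0.9}. -/
/-!  Definition of the Noether number `β(G)` of a group `G`, over the field `ℂ`
(of characteristic 0).  A finite-dimensional `ℂG`-module is (up to isomorphism)
given by a representation `ρ : Representation ℂ G (Fin n → ℂ)`; the algebra of
polynomial invariants is realised inside `MvPolynomial (Fin n) ℂ` as the
common equalizer of the substitution maps induced by the group elements. -/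

/-- The algebra endomorphism of the polynomial ring induced by the linear action of
`g : G` on the underlying space (substitution of the variables by linear forms). -/
noncomputable def Representation.polySubst {G : Type*} [Group G] {n : ℕ}
    (ρ : Representation ℂ G (Fin n → ℂ)) (g : G) :
    MvPolynomial (Fin n) ℂ →ₐ[ℂ] MvPolynomial (Fin n) ℂ :=
  MvPolynomial.aeval fun i =>
    ∑ j, MvPolynomial.C (LinearMap.toMatrix' (ρ g) i j) * MvPolynomial.X j

/-- The subalgebra of `G`-invariant polynomials. -/
noncomputable def Representation.invariantAlgebra {G : Type*} [Group G] {n : ℕ}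
    (ρ : Representation ℂ G (Fin n → ℂ)) : Subalgebra ℂ (MvPolynomial (Fin n) ℂ) :=
  ⨅ g : G, AlgHom.equalizer (ρ.polySubst g) (AlgHom.id ℂ (MvPolynomial (Fin n) ℂ))

/-- The invariant algebra is generated by its elements of (total) degree at most `d`. -/
def Representation.InvariantsGeneratedInDegree {G : Type*} [Group G] {n : ℕ}
    (ρ : Representation ℂ G (Fin n → ℂ)) (d : ℕ) : Prop :=
  Algebra.adjoin ℂ {f : MvPolynomial (Fin n) ℂ | f ∈ ρ.invariantAlgebra ∧ f.totalDegree ≤ d}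
    = ρ.invariantAlgebra

/-- The Noether number `β(G)`: the smallest degree bound `d` such that for every
finite-dimensional `ℂG`-module the algebra of polynomial invariants is generated
by its elements of degree at most `d`.  (Equivalently, the maximum over all
finite-dimensional modules `V` of the minimal generating degree `β(G,V)`.) -/
noncomputable def noetherNumber (G : Type*) [Group G] : ℕ :=
  sInf {d : ℕ | ∀ (n : ℕ) (ρ : Representation ℂ G (Fin n → ℂ)),
    ρ.InvariantsGeneratedInDegree d}

/-- The Noether index `n(G) = |G| / β(G)`, as a real number. -/
noncomputable def noetherIndex (G : Type*) [Group G] : ℝ :=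
  (Nat.card G : ℝ) / (noetherNumber G : ℝ)

theorem Multiset.exists_le_map_eq {α β : Type*} {f : α → β} {s : Multiset α} {t : Multiset β}
    (h : t ≤ s.map f) : ∃ u ≤ s, u.map f = t := by
  induction s using Quotient.inductionOn with | _ l
  induction t using Quotient.inductionOn with | _ k
  obtain ⟨r, hr, hs⟩ := (Multiset.coe_le.1 h : List.Subperm k (l.map f))
  obtain ⟨l', hl', rfl⟩ := List.sublist_map_iff.1 hs
  exact ⟨↑l', Multiset.coe_le.2 hl'.subperm, Quotient.sound hr⟩

open scoped Pointwise in
/-- A Cauchy-Davenport estimate for the sums of partial transversals of `A 0, …, A j`. -/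
theorem ZMod.exists_card_le_transversal_sums {p : ℕ} (hp : p.Prime) (A : ℕ → Finset (ZMod p))
    (h0 : ∀ i, 0 ∉ A i) (hA : (A 0).Nonempty) (j : ℕ) :
    ∃ B : Finset (ZMod p), B.Nonempty ∧ min p (∑ i ∈ Finset.range (j + 1), (A i).card) ≤ B.card ∧
      ∀ x ∈ B, ∃ T ≤ ∑ i ∈ Finset.range (j + 1), (A i).val, T ≠ 0 ∧ T.card ≤ j + 1 ∧ T.sum = x := by
  induction j with
  | zero =>
    refine ⟨A 0, hA, by simp, fun x hx => ⟨{x}, ?_, by simp, by simp, by simp⟩⟩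
    simpa using hx
  | succ j ih =>
    obtain ⟨B, hB, hcard, hsum⟩ := ih
    refine ⟨B + insert 0 (A (j + 1)), hB.add (Finset.insert_nonempty _ _), ?_, ?_⟩
    · have := ZMod.cauchy_davenport hp hB (Finset.insert_nonempty 0 (A (j + 1)))
      rw [Finset.card_insert_of_notMem (h0 _)] at this
      rw [Finset.sum_range_succ]
      omega
    · intro x hx
      obtain ⟨b, hb, c, hc, rfl⟩ := Finset.mem_add.1 hx
      obtain ⟨T, hT, hT0, hTc, rfl⟩ := hsum b hb
      rw [Finset.sum_range_succ]
      rcases Finset.mem_insert.1 hc with rfl | hc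
      · exact ⟨T, hT.trans (Multiset.le_add_right _ _), hT0, by omega, by simp⟩
      · refine ⟨T + {c}, add_le_add hT (Multiset.singleton_le.2 hc), by simp, by simp; omega, by simp⟩

/-- A multiset in `ℤ/p` with at least `p` elements, each counted at most `h` times, contains a
nonempty zero-sum part with at most `h` elements. -/
theorem ZMod.exists_short_zero_sum {p : ℕ} [Fact p.Prime] (T : Multiset (ZMod p)) (h : ℕ)
    (hT : p ≤ ∑ x, min (T.count x) h) :
    ∃ U ≤ T, U ≠ 0 ∧ U.card ≤ h ∧ U.sum = 0 := by
  have hp : p.Prime := Fact.out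
  obtain ⟨h, rfl⟩ : ∃ h', h = h' + 1 := by
    rcases h with _ | h
    · simp at hT; exact absurd hT hp.ne_zero
    · exact ⟨h, rfl⟩
  by_cases h0 : (0 : ZMod p) ∈ T
  · exact ⟨{0}, by simpa using h0, by simp, by simp, by simp⟩
  let A : ℕ → Finset (ZMod p) := fun i => Finset.univ.filter fun x => i < T.count x
  have hsum : ∀ x, ∑ i ∈ Finset.range (h + 1), (if i < T.count x then 1 else 0)
      = min (T.count x) (h + 1) := by
    intro x
    rw [← Finset.card_filter]
    have : (Finset.range (h + 1)).filter (fun i => i < T.count x)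
        = Finset.range (min (T.count x) (h + 1)) := by
      ext i; simp; omega
    rw [this, Finset.card_range]
  have hAcard : ∑ i ∈ Finset.range (h + 1), (A i).card = ∑ x, min (T.count x) (h + 1) := by
    simp_rw [← hsum, A, Finset.card_filter]
    exact Finset.sum_comm
  have hA0 : (A 0).Nonempty := by
    by_contra hne
    have hz : ∀ x, T.count x = 0 := by
      intro x
      by_contra hx
      exact hne ⟨x, by simpa [A, Multiset.one_le_count_iff_mem] using Nat.pos_of_ne_zero hx⟩
    simp [hz] at hT
    exact hp.ne_zero hT
  obtain ⟨B, -, hB, hBsum⟩ := ZMod.exists_card_le_transversal_sums hp A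
    (by intro i; simp [A, Multiset.count_eq_zero_of_notMem h0]) hA0 h
  rw [hAcard, min_eq_left hT] at hB
  have hBu : B = Finset.univ := by
    rw [← Finset.card_eq_iff_eq_univ, ZMod.card]
    exact le_antisymm (by simpa [ZMod.card] using Finset.card_le_univ B) hB
  obtain ⟨U, hU, hU0, hUc, hUs⟩ := hBsum 0 (by simp [hBu])
  refine ⟨U, hU.trans ?_, hU0, hUc, hUs⟩
  rw [Multiset.le_iff_count]
  intro x
  rw [Multiset.count_sum']
  calc ∑ i ∈ Finset.range (h + 1), (A i).val.count x
      = ∑ i ∈ Finset.range (h + 1), (if i < T.count x then 1 else 0) := by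
        refine Finset.sum_congr rfl fun i _ => ?_
        rw [Multiset.count_eq_of_nodup (A i).nodup]
        simp [A]
    _ ≤ T.count x := by rw [hsum]; exact min_le_left _ _

/-- A map with sparse image and large total mass has a level at which a wide gap opens. -/
theorem exists_gap (m k : ℕ) (N : ℕ → ℕ)
    (hk : ((Finset.range m).filter fun c => N c ≠ 0).card < k)
    (hN : ∑ i ∈ Finset.range k, i ^ 2 < ∑ c ∈ Finset.range m, N c) :
    ∃ Y ⊆ Finset.range m, Y.Nonempty ∧ (∀ y ∈ Y, N y ≠ 0) ∧
      ∀ y ∈ Y, ∀ c ∈ Finset.range m \ Y, N c + Y.card + 1 ≤ N y := by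
  classical
  let M := ∑ c ∈ Finset.range m, N c
  let f : ℕ → ℕ := fun T => ((Finset.range m).filter fun c => T ≤ N c).card
  have hanti : ∀ T T', T ≤ T' → f T' ≤ f T := fun T T' h =>
    Finset.card_le_card fun c => by simp only [Finset.mem_filter]; exact fun hc => ⟨hc.1, h.trans hc.2⟩
  have hM : ∑ T ∈ Finset.Icc 1 M, f T = M := by
    simp_rw [f, Finset.card_filter]
    rw [Finset.sum_comm]
    refine Finset.sum_congr rfl fun c hc => ?_
    rw [← Finset.card_filter]
    have hcM : N c ≤ M := Finset.single_le_sum (f := N) (fun _ _ => Nat.zero_le _) hc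
    have : (Finset.Icc 1 M).filter (fun T => T ≤ N c) = Finset.Icc 1 (N c) := by
      ext T; simp; omega
    rw [this]; simp
  have hlt : ∀ T ∈ Finset.Icc 1 M, f T ∈ Finset.range k := by
    intro T hT
    rw [Finset.mem_Icc] at hT
    refine Finset.mem_range.2 (lt_of_le_of_lt (Finset.card_le_card fun c => ?_) hk)
    simp only [Finset.mem_filter]
    exact fun hc => ⟨hc.1, by omega⟩
  have hfib := Finset.sum_fiberwise_of_maps_to hlt f
  have hex : ∃ i ∈ Finset.range k, i ^ 2 < ∑ T ∈ Finset.Icc 1 M with f T = i, f T := by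
    by_contra! hcon
    have := Finset.sum_le_sum hcon
    omega
  obtain ⟨i, -, hi⟩ := hex
  have hsum : ∑ T ∈ Finset.Icc 1 M with f T = i, f T
      = ((Finset.Icc 1 M).filter fun T => f T = i).card * i := by
    rw [Finset.sum_congr rfl (fun T hT => (Finset.mem_filter.1 hT).2)]
    simp
  set F := (Finset.Icc 1 M).filter fun T => f T = i with hF
  rw [hsum, sq] at hi
  have hi' : i < F.card := lt_of_mul_lt_mul_right hi (Nat.zero_le _)
  have hipos : i ≠ 0 := by rintro rfl; simp at hi
  have hFne : F.Nonempty := Finset.card_pos.1 (by omega)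
  have hmin := Finset.mem_filter.1 (F.min'_mem hFne)
  have hmax := Finset.mem_filter.1 (F.max'_mem hFne)
  set a := F.min' hFne
  set b := F.max' hFne
  have hab : F ⊆ Finset.Icc a b := fun T hT =>
    Finset.mem_Icc.2 ⟨F.min'_le _ hT, F.le_max' _ hT⟩
  have hcab := Finset.card_le_card hab
  rw [Nat.card_Icc] at hcab
  have hle : a ≤ b := F.min'_le _ (F.max'_mem hFne)
  have hYeq : (Finset.range m).filter (fun c => b ≤ N c) = (Finset.range m).filter fun c => a ≤ N c :=
    Finset.eq_of_subset_of_card_le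
      (fun c => by simp only [Finset.mem_filter]; exact fun hc => ⟨hc.1, hle.trans hc.2⟩)
      (by have h1 : f a = i := hmin.2
          have h2 : f b = i := hmax.2
          simp only [f] at h1 h2; omega)
  have hYc : ((Finset.range m).filter fun c => b ≤ N c).card = i := hmax.2
  refine ⟨(Finset.range m).filter fun c => b ≤ N c, Finset.filter_subset _ _,
    Finset.card_pos.1 (by omega), fun y hy => ?_, fun y hy c hc => ?_⟩
  · have hby := (Finset.mem_filter.1 hy).2
    have hb1 := (Finset.mem_Icc.1 hmax.1).1
    omega
  have hby := (Finset.mem_filter.1 hy).2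
  rw [hYeq, Finset.mem_sdiff, Finset.mem_filter] at hc
  have hca : N c < a := by
    by_contra h
    exact hc.2 ⟨hc.1, by omega⟩
  rw [hYc]
  omega

/-- Words in weighted letters over `ℤ/p`, evaluated in a commutative algebra, together with an
operator `γ` on the letters that multiplies weights by `lam`, an element of order `m` of `ℤ/p`.
The subspace `W` contains every product of length `d` that has a proper factor of the form
`∑ i < m, γ ^ i b` with `b` a nonempty word of weight zero. -/
structure SwapSystem (p m d : ℕ) (L S : Type*) [CommRing S] [Algebra ℂ S] where
  wt : L → ZMod p
  ev : L → S
  γ : L → L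
  lam : ZMod p
  wt_γ : ∀ x, wt (γ x) = lam * wt x
  lam_pow : lam ^ m = 1
  lam_inj : ∀ i < m, ∀ j < m, lam ^ i = lam ^ j → i = j
  W : Submodule ℂ S
  period : ∀ b : Multiset L, (b.map wt).sum = 0 → ((b.map γ^[m]).map ev).prod = (b.map ev).prod
  trace : ∀ b s : Multiset L, (b.map wt).sum = 0 → b ≠ 0 → s ≠ 0 → b.card + s.card = d →
    (∑ i ∈ Finset.range m, ((b.map γ^[i]).map ev).prod) * (s.map ev).prod ∈ W

namespace SwapSystem

variable {p m d : ℕ} {L S : Type*} [CommRing S] [Algebra ℂ S] (Γ : SwapSystem p m d L S)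

/-- The product of the values of the letters of a word. -/
def eval (w : Multiset L) : S := (w.map Γ.ev).prod

/-- The total weight of a word. -/
def weight (w : Multiset L) : ZMod p := (w.map Γ.wt).sum

/-- The `i`-th iterate of `γ`, applied letterwise. -/
def shift (i : ℕ) (w : Multiset L) : Multiset L := w.map Γ.γ^[i]

/-- The word evaluates into the subspace `W`. -/
def Good (w : Multiset L) : Prop := Γ.eval w ∈ Γ.W

/-- A nonempty word of weight zero. -/
def IsZeroSum (w : Multiset L) : Prop := Γ.weight w = 0 ∧ w ≠ 0

@[simp] theorem eval_add (v w : Multiset L) : Γ.eval (v + w) = Γ.eval v * Γ.eval w := by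
  simp [eval]

theorem eval_sum {ι : Type*} (s : Finset ι) (f : ι → Multiset L) :
    Γ.eval (∑ i ∈ s, f i) = ∏ i ∈ s, Γ.eval (f i) := by
  classical
  induction s using Finset.induction_on with
  | empty => simp [eval]
  | insert a s ha ih => rw [Finset.sum_insert ha, Finset.prod_insert ha, eval_add, ih]

@[simp] theorem weight_zero : Γ.weight 0 = 0 := by simp [weight]

@[simp] theorem weight_add (v w : Multiset L) : Γ.weight (v + w) = Γ.weight v + Γ.weight w := by
  simp [weight]

theorem weight_sum {ι : Type*} (s : Finset ι) (f : ι → Multiset L) :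
    Γ.weight (∑ i ∈ s, f i) = ∑ i ∈ s, Γ.weight (f i) := by
  classical
  induction s using Finset.induction_on with
  | empty => simp
  | insert a s ha ih => rw [Finset.sum_insert ha, Finset.sum_insert ha, weight_add, ih]

theorem shift_sum {ι : Type*} (i : ℕ) (s : Finset ι) (f : ι → Multiset L) :
    Γ.shift i (∑ j ∈ s, f j) = ∑ j ∈ s, Γ.shift i (f j) := by
  simp only [shift, ← Multiset.coe_mapAddMonoidHom, map_sum]

@[simp] theorem card_shift (i : ℕ) (w : Multiset L) : (Γ.shift i w).card = w.card := by
  simp [shift]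

theorem shift_shift (i j : ℕ) (w : Multiset L) : Γ.shift i (Γ.shift j w) = Γ.shift (i + j) w := by
  simp [shift, Multiset.map_map, Function.iterate_add]

theorem wt_iterate (i : ℕ) (x : L) : Γ.wt (Γ.γ^[i] x) = Γ.lam ^ i * Γ.wt x := by
  induction i with
  | zero => simp
  | succ i ih => rw [Function.iterate_succ_apply', Γ.wt_γ, ih, pow_succ]; ring

theorem weight_shift (i : ℕ) (w : Multiset L) :
    Γ.weight (Γ.shift i w) = Γ.lam ^ i * Γ.weight w := by
  simp only [weight, shift, Multiset.map_map, Function.comp_def, wt_iterate]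
  rw [Multiset.sum_map_mul_left]

theorem eval_shift_period {w : Multiset L} (hw : Γ.weight w = 0) :
    Γ.eval (Γ.shift m w) = Γ.eval w := Γ.period w hw

/-- If one piece sits at each position of `Y`, the word is a combination modulo `W` of words in
which some of these pieces have been moved to a common position outside `Y`. -/
theorem good_of_forall_move (Y : Finset ℕ) (hYm : Y ⊆ Finset.range m) (hY : Y.Nonempty)
    (u : ℕ → Multiset L) (E : Multiset L) (hu : ∀ y ∈ Y, Γ.IsZeroSum (u y)) (hE : E ≠ 0)
    (hd : E.card + ∑ y ∈ Y, (u y).card = d)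
    (h : ∀ I ⊆ Y, I.Nonempty → ∀ c ∈ Finset.range m \ Y,
      Γ.Good (E + ∑ y ∈ Y \ I, Γ.shift y (u y) + ∑ y ∈ I, Γ.shift c (u y))) :
    Γ.Good (E + ∑ y ∈ Y, Γ.shift y (u y)) := by
  classical
  let a : ℕ → ℕ → S := fun y c => Γ.eval (Γ.shift c (u y))
  let t : Finset ℕ → ℕ → S := fun I c => Γ.eval E * (∏ y ∈ Y \ I, a y y) * ∏ y ∈ I, a y c
  have ht : ∀ I c, t I c
      = Γ.eval (E + ∑ y ∈ Y \ I, Γ.shift y (u y) + ∑ y ∈ I, Γ.shift c (u y)) := by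
    intro I c
    simp only [t, a, eval_add, eval_sum]
  have hzero : ∑ c ∈ Y, ∑ I ∈ Y.powerset, (-1 : S) ^ I.card * t I c = 0 := by
    refine Finset.sum_eq_zero fun c hc => ?_
    have hprod : ∏ y ∈ Y, (a y y - a y c) = 0 := Finset.prod_eq_zero hc (sub_self _)
    rw [Finset.prod_sub] at hprod
    calc ∑ I ∈ Y.powerset, (-1 : S) ^ I.card * t I c
        = Γ.eval E * ∑ I ∈ Y.powerset, (-1) ^ I.card * (∏ y ∈ Y \ I, a y y) * ∏ y ∈ I, a y c := by
          rw [Finset.mul_sum]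
          exact Finset.sum_congr rfl fun I _ => by simp only [t]; ring
      _ = 0 := by rw [hprod, mul_zero]
  have hmem : ∀ I ⊆ Y, I.Nonempty → ∑ c ∈ Y, t I c ∈ Γ.W := by
    intro I hI hIne
    have htot : ∑ c ∈ Finset.range m, t I c ∈ Γ.W := by
      have hE' : E + ∑ y ∈ Y \ I, Γ.shift y (u y) ≠ 0 := fun h0 =>
        hE (Multiset.le_zero.1 (h0 ▸ Multiset.le_add_right _ _))
      have hb : ∑ y ∈ I, u y ≠ 0 := by
        obtain ⟨y, hy⟩ := hIne
        intro h0
        exact (hu y (hI hy)).2 ((Finset.sum_eq_zero_iff.1 h0) y hy)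
      have hw : Γ.weight (∑ y ∈ I, u y) = 0 := by
        rw [weight_sum]
        exact Finset.sum_eq_zero fun y hy => (hu y (hI hy)).1
      have hc : (∑ y ∈ I, u y).card + (E + ∑ y ∈ Y \ I, Γ.shift y (u y)).card = d := by
        refine Eq.trans ?_ hd
        rw [← Finset.sum_sdiff hI]
        simp only [Multiset.card_add, Multiset.card_sum, card_shift]
        omega
      have := Γ.trace _ _ hw hb hE' hc
      convert this using 1
      rw [Finset.sum_mul]
      refine Finset.sum_congr rfl fun c _ => ?_
      rw [ht, eval_add, mul_comm, ← shift_sum]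
      rfl
    have hout : ∑ c ∈ Finset.range m \ Y, t I c ∈ Γ.W :=
      Submodule.sum_mem _ fun c hc => by rw [ht]; exact h I hI hIne c hc
    have := Finset.sum_sdiff (f := t I) hYm
    rw [← this] at htot
    exact (Submodule.add_mem_iff_right _ hout).1 htot
  rw [Finset.sum_comm] at hzero
  have hempty : ∅ ∈ Y.powerset := Finset.empty_mem_powerset _
  rw [← Finset.add_sum_erase _ _ hempty] at hzero
  have hrest : ∑ I ∈ Y.powerset.erase ∅, ∑ c ∈ Y, (-1 : S) ^ I.card * t I c ∈ Γ.W := by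
    refine Submodule.sum_mem _ fun I hI => ?_
    rw [Finset.mem_erase, Finset.mem_powerset] at hI
    rw [← Finset.mul_sum]
    have := hmem I hI.2 (Finset.nonempty_iff_ne_empty.2 hI.1)
    rcases neg_one_pow_eq_or S I.card with h1 | h1 <;> rw [h1]
    · simpa using this
    · simpa using this
  have hfirst : ∑ c ∈ Y, (-1 : S) ^ (∅ : Finset ℕ).card * t ∅ c
      = (Y.card : ℂ) • Γ.eval (E + ∑ y ∈ Y, Γ.shift y (u y)) := by
    simp only [ht, Finset.card_empty, pow_zero, one_mul, Finset.sdiff_empty, Finset.sum_empty,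
      add_zero, Finset.sum_const, Nat.cast_smul_eq_nsmul]
  rw [hfirst] at hzero
  have hcard : (Y.card : ℂ) ≠ 0 := Nat.cast_ne_zero.2 (Finset.card_pos.2 hY).ne'
  refine (Submodule.smul_mem_iff _ hcard).1 ?_
  rw [eq_neg_of_add_eq_zero_left hzero]
  exact Γ.W.neg_mem hrest

/-- Moving pieces to a common position of low multiplicity lowers the sum of the squares of the
multiplicities. -/
theorem sum_sq_card_lt {n : ℕ} (π : Fin n → ℕ) (I Y : Finset ℕ) (hIY : I ⊆ Y) (hI : I.Nonempty)
    (hYm : Y ⊆ Finset.range m) (sec : ℕ → Fin n) (hsec : ∀ y ∈ Y, π (sec y) = y)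
    (c : ℕ) (hc : c ∈ Finset.range m \ Y)
    (hgap : ∀ y ∈ Y, (Finset.univ.filter fun j => π j = c).card + Y.card + 1
      ≤ (Finset.univ.filter fun j => π j = y).card) :
    ∑ x ∈ Finset.range m,
        (Finset.univ.filter fun j => (if j ∈ I.image sec then c else π j) = x).card ^ 2
      < ∑ x ∈ Finset.range m, (Finset.univ.filter fun j => π j = x).card ^ 2 := by
  classical
  rw [Finset.mem_sdiff] at hc
  have hinj : Set.InjOn sec I := fun y hy z hz hyz => by
    rw [← hsec y (hIY hy), hyz, hsec z (hIY hz)]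
  have hN : ∀ x, ((Finset.univ.filter fun j => (if j ∈ I.image sec then c else π j) = x).card : ℤ)
      = (Finset.univ.filter fun j => π j = x).card
        + ((if x = c then (I.card : ℤ) else 0) - if x ∈ I then 1 else 0) := by
    intro x
    rw [Finset.card_filter, Finset.card_filter]
    push_cast
    have h1 : ∀ j, ((if (if j ∈ I.image sec then c else π j) = x then 1 else 0 : ℤ))
        = (if π j = x then 1 else 0) + if j ∈ I.image sec then
          ((if c = x then 1 else 0) - if π j = x then 1 else 0) else 0 := by
      intro j; split_ifs <;> simp
    simp_rw [h1]
    rw [Finset.sum_add_distrib, Finset.sum_ite_mem, Finset.univ_inter, Finset.sum_image hinj,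
      Finset.sum_sub_distrib]
    congr 2
    · by_cases hx : x = c
      · simp [hx]
      · simp [hx, Ne.symm hx]
    · rw [Finset.sum_congr rfl fun y hy => by rw [hsec y (hIY hy)]]
      simp
  set N : ℕ → ℕ := fun x => (Finset.univ.filter fun j => π j = x).card
  have hkey : ∑ x ∈ Finset.range m,
      ((N x + ((if x = c then (I.card : ℤ) else 0) - if x ∈ I then 1 else 0)) ^ 2 - (N x : ℤ) ^ 2)
      = (I.card ^ 2 + 2 * N c * I.card) + ∑ y ∈ I, (1 - 2 * (N y : ℤ)) := by
    have h1 : ∀ x, ((N x + ((if x = c then (I.card : ℤ) else 0) - if x ∈ I then 1 else 0)) ^ 2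
        - (N x : ℤ) ^ 2) = (if x = c then (I.card ^ 2 + 2 * N c * I.card : ℤ) else 0)
          + if x ∈ I then (1 - 2 * (N x : ℤ)) else 0 := by
      intro x
      by_cases hx : x = c
      · have : c ∉ I := fun h => hc.2 (hIY h)
        subst hx; simp [this]; ring
      · by_cases hxI : x ∈ I
        · simp [hx, hxI]; ring
        · simp [hx, hxI]
    simp_rw [h1]
    rw [Finset.sum_add_distrib, Finset.sum_ite_eq' _ c, if_pos hc.1, Finset.sum_ite_mem,
      Finset.inter_eq_right.2 (hIY.trans hYm)]
  have hbound : ∑ y ∈ I, (1 - 2 * (N y : ℤ)) ≤ I.card * (1 - 2 * (N c + I.card + 1)) := by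
    rw [← nsmul_eq_mul]
    refine Finset.sum_le_card_nsmul _ _ _ fun y hy => ?_
    have h2 : N c + Y.card + 1 ≤ N y := hgap y (hIY hy)
    have h3 := Finset.card_le_card hIY
    have : (N c : ℤ) + I.card + 1 ≤ N y := by exact_mod_cast (by omega : N c + I.card + 1 ≤ N y)
    linarith
  have hIc : (0 : ℤ) < I.card := by exact_mod_cast Finset.card_pos.2 hI
  rw [← Nat.cast_lt (α := ℤ)]
  simp only [Nat.cast_sum, Nat.cast_pow, hN]
  rw [← sub_neg, ← Finset.sum_sub_distrib, hkey]
  nlinarith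

/-- To show that words made of many pieces are good it suffices to consider the case in which the
pieces occupy at least `k` different positions. -/
theorem good_of_many_positions {n : ℕ} (u : Fin n → Multiset L) (E : Multiset L)
    (hu : ∀ j, Γ.IsZeroSum (u j)) (hE : E ≠ 0) (hd : E.card + ∑ j, (u j).card = d) (k : ℕ)
    (hn : ∑ i ∈ Finset.range k, i ^ 2 < n)
    (h : ∀ π : Fin n → ℕ, (∀ j, π j < m) → k ≤ (Finset.univ.image π).card →
      Γ.Good (E + ∑ j, Γ.shift (π j) (u j)))
    (π : Fin n → ℕ) (hπ : ∀ j, π j < m) : Γ.Good (E + ∑ j, Γ.shift (π j) (u j)) := by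
  classical
  induction hM : ∑ x ∈ Finset.range m, (Finset.univ.filter fun j => π j = x).card ^ 2
    using Nat.strong_induction_on generalizing π with
  | _ M ih =>
    by_cases hk : k ≤ (Finset.univ.image π).card
    · exact h π hπ hk
    have hmaps : ∀ j ∈ (Finset.univ : Finset (Fin n)), π j ∈ Finset.range m := fun j _ =>
      Finset.mem_range.2 (hπ j)
    obtain ⟨Y, hYm, hY, hY0, hgap⟩ := exists_gap m k
      (fun x => (Finset.univ.filter fun j => π j = x).card)
      (by
        refine lt_of_le_of_lt (Finset.card_le_card fun x hx => ?_) (not_le.1 hk)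
        obtain ⟨j, hj⟩ := Finset.card_ne_zero.1 (Finset.mem_filter.1 hx).2
        exact Finset.mem_image.2 ⟨j, Finset.mem_univ _, (Finset.mem_filter.1 hj).2⟩)
      (by rw [← Finset.card_eq_sum_card_fiberwise hmaps]; simpa using hn)
    have hex : ∀ y, ∃ j, y ∈ Y → π j = y := by
      intro y
      by_cases hy : y ∈ Y
      · obtain ⟨j, hj⟩ := Finset.card_ne_zero.1 (hY0 y hy)
        exact ⟨j, fun _ => (Finset.mem_filter.1 hj).2⟩
      · exact ⟨⟨0, by omega⟩, fun h => absurd h hy⟩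
    choose sec hsec using hex
    have hinj : Set.InjOn sec Y := fun y hy z hz hyz => by
      rw [← hsec y hy, hyz, hsec z hz]
    have hsplit : ∀ f : Fin n → Multiset L,
        ∑ j, f j = ∑ j ∈ Finset.univ \ Y.image sec, f j + ∑ y ∈ Y, f (sec y) := by
      intro f
      rw [← Finset.sum_image hinj, Finset.sum_sdiff (Finset.subset_univ _)]
    have hYsum : ∑ y ∈ Y, Γ.shift (π (sec y)) (u (sec y)) = ∑ y ∈ Y, Γ.shift y (u (sec y)) :=
      Finset.sum_congr rfl fun y hy => by rw [hsec y hy]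
    rw [hsplit, hYsum, ← add_assoc]
    refine Γ.good_of_forall_move Y hYm hY (fun y => u (sec y)) _ (fun y _ => hu _) ?_ ?_ ?_
    · exact fun h0 => hE (Multiset.le_zero.1 (h0 ▸ Multiset.le_add_right _ _))
    · refine Eq.trans ?_ hd
      rw [Multiset.card_add, Multiset.card_sum, add_assoc]
      congr 1
      simp only [card_shift]
      rw [← Finset.sum_image (f := fun j => (u j).card) hinj,
        Finset.sum_sdiff (Finset.subset_univ _)]
    · intro I hI hIne c hc
      have hlt := sum_sq_card_lt π I Y hI hIne hYm sec hsec c hc fun y hy => hgap y hy c hc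
      have hgood := ih _ (hM ▸ hlt) (fun j => if j ∈ I.image sec then c else π j)
        (fun j => by
          split_ifs
          · exact Finset.mem_range.1 (Finset.mem_sdiff.1 hc).1
          · exact hπ j) rfl
      convert hgood using 1
      rw [hsplit, add_assoc, add_assoc]
      congr 1
      congr 1
      · refine Finset.sum_congr rfl fun j hj => ?_
        rw [if_neg]
        exact fun h => (Finset.mem_sdiff.1 hj).2 (Finset.image_subset_image hI h)
      · rw [← Finset.sum_sdiff hI]
        congr 1
        · refine Finset.sum_congr rfl fun y hy => ?_
          rw [Finset.mem_sdiff] at hy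
          rw [if_neg, hsec y hy.1]
          intro h
          obtain ⟨z, hz, hzy⟩ := Finset.mem_image.1 h
          exact hy.2 (hinj (hI hz) hy.1 hzy ▸ hz)
        · exact Finset.sum_congr rfl fun y hy => by rw [if_pos (Finset.mem_image_of_mem _ hy)]

end SwapSystem

namespace SwapSystem

variable {p m d : ℕ} {L S : Type*} [CommRing S] [Algebra ℂ S] (Γ : SwapSystem p m d L S)

theorem le_of_prime (Γ : SwapSystem p m d L S) [hp : Fact p.Prime] : m + 1 ≤ p := by
  have hlam : ∀ i < m, Γ.lam ^ i ≠ 0 := fun i hi h0 => by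
    have h1 := Γ.lam_pow
    have h2 := pow_add Γ.lam i (m - i)
    rw [Nat.add_sub_cancel' hi.le, h0, zero_mul, h1] at h2
    exact one_ne_zero h2
  have := Finset.card_le_card (show (Finset.range m).image (fun i => Γ.lam ^ i) ⊆ {0}ᶜ from
    fun x hx => by
      obtain ⟨i, hi, rfl⟩ := Finset.mem_image.1 hx
      simpa using hlam i (Finset.mem_range.1 hi))
  rw [Finset.card_image_of_injOn
    (fun i hi j hj => Γ.lam_inj i (by simpa using hi) j (by simpa using hj)),
    Finset.card_compl, ZMod.card] at this
  have := hp.out.pos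
  simp at *
  omega

theorem exists_isZeroSum_le [Fact p.Prime] (w : Multiset L) (h : ℕ)
    (hw : p ≤ ∑ x, min ((w.map Γ.wt).count x) h) :
    ∃ b ≤ w, Γ.IsZeroSum b ∧ b.card ≤ h := by
  obtain ⟨U, hU, hU0, hUc, hUs⟩ := ZMod.exists_short_zero_sum _ h hw
  obtain ⟨b, hb, rfl⟩ := Multiset.exists_le_map_eq hU
  refine ⟨b, hb, ⟨hUs, ?_⟩, by simpa using hUc⟩
  rintro rfl
  exact hU0 rfl

theorem exists_isZeroSum_le_of_card [Fact p.Prime] (w : Multiset L) (hw : p ≤ w.card) :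
    ∃ b ≤ w, Γ.IsZeroSum b ∧ b.card ≤ p := by
  apply Γ.exists_isZeroSum_le
  by_cases hx : ∃ x, p ≤ (w.map Γ.wt).count x
  · obtain ⟨x, hx⟩ := hx
    calc p = min ((w.map Γ.wt).count x) p := by omega
      _ ≤ _ := Finset.single_le_sum (f := fun x => min ((w.map Γ.wt).count x) p)
        (fun _ _ => Nat.zero_le _) (Finset.mem_univ x)
  · push Not at hx
    rw [Finset.sum_congr rfl fun x _ => min_eq_left (hx x).le, Multiset.sum_count_eq_card (by simp)]
    simpa using hw

/-- A word of weight zero and length more than `r * p` splits off `r` zero-sum pieces. -/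
theorem exists_pieces [Fact p.Prime] (r : ℕ) (w : Multiset L) (hw : Γ.weight w = 0)
    (hc : r * p < w.card) : ∃ (ss : Multiset (Multiset L)) (E : Multiset L),
      ss.card = r ∧ (∀ b ∈ ss, Γ.IsZeroSum b) ∧ E ≠ 0 ∧ ss.sum + E = w := by
  induction r generalizing w with
  | zero =>
    refine ⟨0, w, rfl, by simp, ?_, by simp⟩
    rintro rfl
    simp at hc
  | succ r ih =>
    rw [Nat.succ_mul] at hc
    obtain ⟨b, hb, hbz, hbc⟩ := Γ.exists_isZeroSum_le_of_card w (by omega)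
    obtain ⟨v, rfl⟩ := Multiset.le_iff_exists_add.1 hb
    obtain ⟨ss, E, hss, hz, hE, rfl⟩ := ih v (by simpa [hbz.1] using hw)
      (by rw [Multiset.card_add] at hc; omega)
    exact ⟨b ::ₘ ss, E, by simp [hss], by simpa using ⟨hbz, hz⟩, hE, by simp [add_assoc]⟩

/-- A word with `m` zero-sum pieces and a nonempty rest is good. -/
theorem good_of_pieces (hm : 0 < m) (ss : Multiset (Multiset L)) (E : Multiset L)
    (hss : m ≤ ss.card) (hz : ∀ b ∈ ss, Γ.IsZeroSum b) (hE : E ≠ 0)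
    (hd : (ss.sum + E).card = d) : Γ.Good (ss.sum + E) := by
  obtain ⟨l, rfl⟩ := Quot.exists_rep ss
  change Γ.Good ((l : Multiset (Multiset L)).sum + E)
  change ((l : Multiset (Multiset L)).sum + E).card = d at hd
  change m ≤ l.length at hss
  change ∀ b ∈ l, Γ.IsZeroSum b at hz
  rw [Multiset.sum_coe] at hd ⊢
  have hsum : l.sum = ∑ y ∈ Finset.range m, l.getD y 0 + (l.drop m).sum := by
    conv_lhs => rw [← List.take_append_drop m l, List.sum_append]
    congr 1
    rw [← Fin.sum_univ_getElem, Finset.sum_range]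
    have hl : (l.take m).length = m := by simp [hss]
    refine Fintype.sum_equiv (finCongr hl) _ _ fun i => ?_
    have : (i : ℕ) < l.length := by have := i.2; omega
    simp [this]
  have hzs : ∀ y < m, Γ.IsZeroSum (l.getD y 0) := fun y hy => by
    rw [List.getD_eq_getElem _ _ (hy.trans_le hss)]
    exact hz _ (List.getElem_mem _)
  have key := Γ.good_of_forall_move (Finset.range m) le_rfl ⟨0, by simpa using hm⟩
    (fun y => Γ.shift (m - y) (l.getD y 0)) ((l.drop m).sum + E)
    (fun y hy => ⟨by rw [weight_shift, (hzs y (by simpa using hy)).1, mul_zero], fun h0 =>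
      (hzs y (by simpa using hy)).2 (by simpa [shift] using h0)⟩)
    (fun h0 => hE (Multiset.le_zero.1 (h0 ▸ Multiset.le_add_left _ _)))
    (by
      refine Eq.trans ?_ hd
      rw [hsum]
      simp only [Multiset.card_add, Multiset.card_sum, card_shift]
      omega)
    (fun I _ _ c hc => by simp at hc)
  have heval : Γ.eval (∑ y ∈ Finset.range m, Γ.shift y (Γ.shift (m - y) (l.getD y 0)))
      = Γ.eval (∑ y ∈ Finset.range m, l.getD y 0) := by
    rw [eval_sum, eval_sum]
    refine Finset.prod_congr rfl fun y hy => ?_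
    rw [Finset.mem_range] at hy
    rw [shift_shift, Nat.add_sub_cancel' hy.le, eval_shift_period _ (hzs y hy).1]
  unfold Good at key ⊢
  rw [eval_add, heval, ← eval_add] at key
  convert key using 2
  rw [hsum]
  abel

/-- All words of length `d` with at least `t` disjoint zero-sum pieces of length at most `h`
are good. -/
def GoodOfShort (h t : ℕ) : Prop :=
  ∀ (ss : Multiset (Multiset L)) (v : Multiset L), ss.card = t →
    (∀ b ∈ ss, Γ.IsZeroSum b ∧ b.card ≤ h) → Γ.weight v = 0 → (ss.sum + v).card = d →
      Γ.Good (ss.sum + v)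

theorem GoodOfShort.good_of_le {Γ : SwapSystem p m d L S} {h t : ℕ} (H : Γ.GoodOfShort h (t + 1))
    {ss : Multiset (Multiset L)} {v b : Multiset L} (hss : ss.card = t)
    (hz : ∀ b ∈ ss, Γ.IsZeroSum b ∧ b.card ≤ h) (hv : Γ.weight v = 0)
    (hd : (ss.sum + v).card = d) (hbv : b ≤ v) (hb : Γ.IsZeroSum b) (hbh : b.card ≤ h) :
    Γ.Good (ss.sum + v) := by
  obtain ⟨v', rfl⟩ := Multiset.le_iff_exists_add.1 hbv
  have heq : ss.sum + (b + v') = (b ::ₘ ss).sum + v' := by simp [add_assoc, add_left_comm]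
  rw [heq] at hd ⊢
  refine H _ _ (by simp [hss]) ?_ (by simpa [hb.1] using hv) hd
  intro c hc
  rcases Multiset.mem_cons.1 hc with rfl | hc
  · exact ⟨hb, hbh⟩
  · exact hz c hc

theorem card_sum_le {h : ℕ} {ss : Multiset (Multiset L)} (hz : ∀ b ∈ ss, b.card ≤ h) :
    ss.sum.card ≤ ss.card * h := by
  induction ss using Multiset.induction_on with
  | empty => simp
  | cons b ss ih =>
    have h1 := hz b (by simp)
    have h2 := ih fun c hc => hz c (by simp [hc])
    simp only [Multiset.sum_cons, Multiset.card_add, Multiset.card_cons, Nat.succ_mul]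
    omega

/-- Downward induction on the number of short zero-sum pieces. -/
theorem good_of_step [Fact p.Prime] (hm : 0 < m) (h : ℕ) (hd : m * h < d)
    (step : ∀ t < m, Γ.GoodOfShort h (t + 1) → ∀ (ss : Multiset (Multiset L)) (v : Multiset L),
      ss.card = t → (∀ b ∈ ss, Γ.IsZeroSum b ∧ b.card ≤ h) → Γ.weight v = 0 →
      (ss.sum + v).card = d → (∀ b ≤ v, Γ.IsZeroSum b → h < b.card) → d ≤ t * h + v.card →
      v.card ≤ (m - t) * p → Γ.Good (ss.sum + v))
    (w : Multiset L) (hw : Γ.weight w = 0) (hwd : w.card = d) : Γ.Good w := by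
  have key : ∀ t ≤ m, Γ.GoodOfShort h t := by
    intro t ht
    induction ht using Nat.decreasingInduction with
    | self =>
      intro ss v hss hz _ hcard
      refine Γ.good_of_pieces hm ss v hss.ge (fun b hb => (hz b hb).1) ?_ hcard
      rintro rfl
      have := card_sum_le fun b hb => (hz b hb).2
      rw [hss] at this
      simp at hcard
      omega
    | of_succ t ht ih =>
      intro ss v hss hz hv hcard
      by_cases hb : ∃ b ≤ v, Γ.IsZeroSum b ∧ b.card ≤ h
      · obtain ⟨b, hbv, hb, hbh⟩ := hb
        exact ih.good_of_le hss hz hv hcard hbv hb hbh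
      push Not at hb
      by_cases hlarge : v.card ≤ (m - t) * p
      · refine step t ht ih ss v hss hz hv hcard hb ?_ hlarge
        have := card_sum_le fun b hb => (hz b hb).2
        rw [hss] at this
        rw [Multiset.card_add] at hcard
        omega
      · obtain ⟨ss', E, hss', hz', hE, rfl⟩ := Γ.exists_pieces (m - t) v hv (not_le.1 hlarge)
        have heq : ss.sum + (ss'.sum + E) = (ss + ss').sum + E := by simp [add_assoc]
        rw [heq] at hcard ⊢
        refine Γ.good_of_pieces hm _ E (by simp [hss, hss']; omega) ?_ hE hcard
        intro b hb
        rcases Multiset.mem_add.1 hb with hb | hb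
        · exact (hz b hb).1
        · exact hz' b hb
  simpa using key 0 (Nat.zero_le _) 0 w rfl (by simp) hw (by simpa using hwd)

/-- A long word without short zero-sum parts contains some nonzero weight many times. -/
theorem exists_lt_count [Fact p.Prime] (v : Multiset L) {h k B : ℕ} (hh : 0 < h) (hkh : p ≤ k * h)
    (hv : ∀ b ≤ v, Γ.IsZeroSum b → h < b.card) (hB : h ≤ B)
    (hcard : p - 1 + (k - 1) * (B - h) < v.card) :
    ∃ a ≠ 0, B < (v.map Γ.wt).count a := by
  by_contra! hcon
  set N := fun x => (v.map Γ.wt).count x with hN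
  have hmin : ∑ x, min (N x) h < p := by
    by_contra! hle
    obtain ⟨b, hb, hbz, hbc⟩ := Γ.exists_isZeroSum_le v h hle
    exact absurd hbc (not_le.2 (hv b hb hbz))
  have h0 : N 0 = 0 := by
    rw [hN]
    refine Multiset.count_eq_zero_of_notMem fun hmem => ?_
    obtain ⟨x, hx, hx0⟩ := Multiset.mem_map.1 hmem
    have := hv {x} (by simpa using hx) ⟨by simpa [weight] using hx0, by simp⟩
    simp at this
    omega
  have hNB : ∀ x, N x ≤ B := fun x => by
    by_cases hx : x = 0
    · subst hx; omega
    · exact hcon x hx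
  have hl : (Finset.univ.filter fun x => h ≤ N x).card * h ≤ ∑ x, min (N x) h := by
    rw [← smul_eq_mul, ← Finset.sum_const]
    refine le_trans (Finset.sum_le_sum fun x hx => ?_)
      (Finset.sum_le_univ_sum_of_nonneg fun _ => Nat.zero_le _)
    have := (Finset.mem_filter.1 hx).2
    omega
  have hlk : (Finset.univ.filter fun x => h ≤ N x).card ≤ k - 1 := by
    have : (Finset.univ.filter fun x => h ≤ N x).card < k :=
      lt_of_mul_lt_mul_right (lt_of_le_of_lt hl (hmin.trans_le hkh)) (Nat.zero_le _)
    omega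
  have hsum : v.card ≤ ∑ x, (min (N x) h + if h ≤ N x then B - h else 0) := by
    have : v.card = ∑ x, N x := by
      rw [hN, Multiset.sum_count_eq_card (by simp)]; simp
    rw [this]
    refine Finset.sum_le_sum fun x _ => ?_
    have := hNB x
    split_ifs <;> omega
  rw [Finset.sum_add_distrib, ← Finset.sum_filter, Finset.sum_const, smul_eq_mul] at hsum
  have := Nat.mul_le_mul_right (B - h) hlk
  omega

/-- Letters of a common weight can be grouped into pieces of `p` letters each. -/
theorem exists_pure_pieces (a : ZMod p) (n : ℕ) (v : Multiset L)
    (hn : n * p ≤ (v.map Γ.wt).count a) :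
    ∃ (u : Fin n → Multiset L) (v' : Multiset L), (∀ j, (u j).card = p ∧ (u j).map Γ.wt =
      Multiset.replicate p a) ∧ v' + ∑ j, u j = v := by
  induction n generalizing v with
  | zero => exact ⟨fun _ => 0, v, fun j => j.elim0, by simp⟩
  | succ n ih =>
    rw [Nat.succ_mul] at hn
    obtain ⟨b, hb, hba⟩ := Multiset.exists_le_map_eq (f := Γ.wt) (s := v)
      (Multiset.le_count_iff_replicate_le.1 (show p ≤ (v.map Γ.wt).count a by omega))
    obtain ⟨v₁, rfl⟩ := Multiset.le_iff_exists_add.1 hb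
    obtain ⟨u, v', hu, rfl⟩ := ih v₁ (by
      rw [Multiset.map_add, Multiset.count_add, hba, Multiset.count_replicate_self] at hn
      omega)
    refine ⟨Fin.cons b u, v', fun j => ?_, by rw [Fin.sum_univ_succ]; simp; abel⟩
    refine Fin.cases ?_ (fun i => ?_) j
    · exact ⟨by simpa using congrArg Multiset.card hba, hba⟩
    · simpa using hu i

theorem isZeroSum_of_pure [hp : Fact p.Prime] {a : ZMod p} {u : Multiset L}
    (hu : u.card = p ∧ u.map Γ.wt = Multiset.replicate p a) : Γ.IsZeroSum u := by
  refine ⟨by simp [weight, hu.2], ?_⟩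
  rintro rfl
  exact hp.out.ne_zero (by simpa using hu.1.symm)

theorem map_wt_shift_of_pure {a : ZMod p} {u : Multiset L} (i : ℕ)
    (hu : u.map Γ.wt = Multiset.replicate p a) :
    (Γ.shift i u).map Γ.wt = Multiset.replicate p (Γ.lam ^ i * a) := by
  have : (Γ.shift i u).map Γ.wt = (u.map Γ.wt).map fun x => Γ.lam ^ i * x := by
    simp [shift, Multiset.map_map, wt_iterate]
  rw [this, hu, Multiset.map_replicate]

@[simp] theorem shift_zero (w : Multiset L) : Γ.shift 0 w = w := by simp [shift]

theorem GoodOfShort.good_of_count [hp : Fact p.Prime] {Γ : SwapSystem p m d L S} {h k t n : ℕ}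
    (hm : 0 < m) (H : Γ.GoodOfShort h (t + 1)) (hhp : h ≤ p) (hkh : p ≤ k * h)
    (hn : ∑ i ∈ Finset.range k, i ^ 2 < n) (hnd : n * p < d)
    {ss : Multiset (Multiset L)} {v : Multiset L} (hss : ss.card = t)
    (hz : ∀ b ∈ ss, Γ.IsZeroSum b ∧ b.card ≤ h) (hv : Γ.weight v = 0)
    (hd : (ss.sum + v).card = d) {a : ZMod p} (ha : a ≠ 0)
    (hcount : n * p ≤ (v.map Γ.wt).count a) : Γ.Good (ss.sum + v) := by
  classical
  obtain ⟨u, v', hu, rfl⟩ := Γ.exists_pure_pieces a n v hcount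
  have hcard : (ss.sum + v').card + ∑ j, (u j).card = d := by
    refine Eq.trans ?_ hd
    simp only [Multiset.card_add, Multiset.card_sum]
    omega
  have hE : ss.sum + v' ≠ 0 := by
    intro h0
    rw [h0, Finset.sum_congr rfl fun j _ => (hu j).1] at hcard
    simp at hcard
    omega
  have := Γ.good_of_many_positions u (ss.sum + v') (fun j => Γ.isZeroSum_of_pure (hu j)) hE hcard k
    hn ?_ (fun _ => 0) fun _ => hm
  · simpa [add_assoc] using this
  intro π hπ hk
  set v'' := v' + ∑ j, Γ.shift (π j) (u j)
  have hle : p ≤ ∑ x, min ((v''.map Γ.wt).count x) h := by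
    have hinj : Set.InjOn (fun i => Γ.lam ^ i * a) (Finset.univ.image π : Finset ℕ) := by
      intro i hi j hj hij
      simp only [Finset.coe_image, Finset.coe_univ, Set.image_univ, Set.mem_range] at hi hj
      obtain ⟨i, rfl⟩ := hi
      obtain ⟨j, rfl⟩ := hj
      exact Γ.lam_inj _ (hπ i) _ (hπ j) (mul_right_cancel₀ ha hij)
    calc p ≤ k * h := hkh
      _ ≤ (Finset.univ.image π).card * h := Nat.mul_le_mul_right _ hk
      _ = ∑ x ∈ (Finset.univ.image π).image (fun i => Γ.lam ^ i * a), h := by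
        rw [Finset.sum_const, Finset.card_image_of_injOn hinj, smul_eq_mul]
      _ ≤ ∑ x ∈ (Finset.univ.image π).image (fun i => Γ.lam ^ i * a),
          min ((v''.map Γ.wt).count x) h := by
        refine Finset.sum_le_sum fun x hx => ?_
        obtain ⟨i, hi, rfl⟩ := Finset.mem_image.1 hx
        obtain ⟨j, -, rfl⟩ := Finset.mem_image.1 hi
        refine le_min (hhp.trans ?_) le_rfl
        rw [Multiset.le_count_iff_replicate_le, ← Γ.map_wt_shift_of_pure _ (hu j).2]
        refine Multiset.map_le_map (le_trans ?_ (Multiset.le_add_left _ _))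
        exact Finset.single_le_sum (f := fun j => Γ.shift (π j) (u j))
          (fun _ _ => Multiset.zero_le _) (Finset.mem_univ j)
      _ ≤ _ := Finset.sum_le_univ_sum_of_nonneg fun _ => Nat.zero_le _
  obtain ⟨b, hb, hbz, hbh⟩ := Γ.exists_isZeroSum_le v'' h hle
  rw [add_assoc]
  refine H.good_of_le hss hz ?_ ?_ hb hbz hbh
  · have hv'0 : Γ.weight v' = 0 := by
      rw [weight_add, weight_sum, Finset.sum_eq_zero fun j _ => (Γ.isZeroSum_of_pure (hu j)).1,
        add_zero] at hv
      exact hv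
    rw [weight_add, hv'0, weight_sum, zero_add]
    exact Finset.sum_eq_zero fun j _ => by
      rw [weight_shift, (Γ.isZeroSum_of_pure (hu j)).1, mul_zero]
  · refine Eq.trans ?_ hcard
    simp only [Multiset.card_add, Multiset.card_sum, card_shift]
    omega

end SwapSystem

theorem add_three_pow_ten_le (m : ℕ) (h5 : 5 ≤ m) (h800 : m < 800) :
    (m + 3) ^ 10 ≤ 1024 * m ^ 9 := by
  have key : ∀ m < 800, 5 ≤ m → (m + 3) ^ 10 ≤ 1024 * m ^ 9 := by
    decide +kernel
  exact key m h800 h5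

theorem le_rpow_nine_tenths {x y : ℝ} (hy : 0 ≤ y) (h : x ^ 10 ≤ y ^ 9) :
    x ≤ y ^ (0.9 : ℝ) := by
  refine le_of_pow_le_pow_left₀ (n := 10) (by norm_num) (Real.rpow_nonneg hy _) (h.trans_eq ?_)
  rw [← Real.rpow_natCast, ← Real.rpow_natCast, ← Real.rpow_mul hy]
  norm_num

theorem sum_range_sq (k : ℕ) :
    (∑ i ∈ Finset.range (k + 1), i ^ 2 : ℕ) = (k * (k + 1) * (2 * k + 1) / 6 : ℝ) := by
  induction k with
  | zero => simp
  | succ k ih =>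
    rw [Finset.sum_range_succ, Nat.cast_add, ih]
    push_cast
    ring

namespace SwapSystem

variable {p m d : ℕ} {L S : Type*} [CommRing S] [Algebra ℂ S] (Γ : SwapSystem p m d L S)

theorem good_of_parameters [hp : Fact p.Prime] (hm : 0 < m) {h k n : ℕ} (hh : 0 < h) (hhp : h ≤ p)
    (hkh : p ≤ k * h) (hn : ∑ i ∈ Finset.range k, i ^ 2 < n) (hn2 : 2 ≤ n) (hnd : n * p < d)
    (hmd : m * h < d)
    (hbound : ∀ t < m, ∀ c, c ≤ (m - t) * p → d ≤ t * h + c →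
      p - 1 + (k - 1) * (n * p - 1 - h) < c)
    (w : Multiset L) (hw : Γ.weight w = 0) (hwd : w.card = d) : Γ.Good w := by
  refine Γ.good_of_step hm h hmd (fun t ht H ss v hss hz hv hd hlong hdt hle => ?_) w hw hwd
  have := Nat.mul_le_mul_right p hn2
  have hp0 := hp.out.pos
  obtain ⟨a, ha, hac⟩ := Γ.exists_lt_count v hh hkh hlong (show h ≤ n * p - 1 by omega)
    (hbound t ht _ hle hdt)
  exact H.good_of_count hm hhp hkh hn hnd hss hz hv hd ha (by omega)

theorem good_of_two [hp : Fact p.Prime] (Γ : SwapSystem p 2 d L S) (hd : 3 * p + 1 < 2 * d)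
    (w : Multiset L) (hw : Γ.weight w = 0) (hwd : w.card = d) : Γ.Good w := by
  have hp3 := Γ.le_of_prime
  obtain ⟨h, hh⟩ : ∃ h, p + 1 = 2 * h := by
    rcases hp.out.eq_two_or_odd' with h | ⟨r, hr⟩
    · omega
    · exact ⟨r + 1, by omega⟩
  refine Γ.good_of_step two_pos h (by omega) (fun t ht H ss v hss hz hv hd' hlong hdt hle => ?_)
    w hw hwd
  have ht0 : t = 0 := by
    by_contra hne
    obtain rfl : t = 1 := by omega
    omega
  subst ht0
  obtain ⟨a, ha, hac⟩ := Γ.exists_lt_count (k := 2) (B := p) v (by omega) (by omega) hlong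
    (by omega) (by omega)
  obtain rfl := Multiset.card_eq_zero.1 hss
  obtain ⟨u, v', hu, rfl⟩ := Γ.exists_pure_pieces a 1 v (by omega)
  simp only [Multiset.sum_zero, zero_add, Finset.univ_unique, Fin.default_eq_zero,
    Finset.sum_singleton] at *
  have hu0 := Γ.isZeroSum_of_pure (hu 0)
  have hlam : Γ.lam = -1 := by
    have h1 := Γ.lam_pow
    rcases (by simpa using h1 : Γ.lam = 1 ∨ Γ.lam = -1) with h | h
    · have := Γ.lam_inj 0 (by omega) 1 (by omega) (by simp [h])
      omega
    · exact h
  have hv'a : a ∈ v'.map Γ.wt := by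
    rw [Multiset.map_add, Multiset.count_add, (hu 0).2, Multiset.count_replicate_self] at hac
    have hpos : 0 < (v'.map Γ.wt).count a :=
      Nat.lt_of_add_lt_add_right (n := p) (by simpa using hac)
    exact Multiset.count_pos.1 hpos
  have hua : -a ∈ (Γ.shift 1 (u 0)).map Γ.wt := by
    rw [Γ.map_wt_shift_of_pure 1 (hu 0).2, hlam]
    exact Multiset.mem_replicate.2 ⟨hp.out.ne_zero, by ring⟩
  obtain ⟨x, hx, hxa⟩ := Multiset.mem_map.1 hv'a
  obtain ⟨y, hy, hya⟩ := Multiset.mem_map.1 hua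
  have := Γ.good_of_forall_move {0} (by simp) (by simp) (fun _ => u 0) v' (fun _ _ => hu0)
    (by rintro rfl; simp at hx) (by simpa using hd') ?_
  · simpa using this
  intro I hI hIne c hc
  obtain rfl := (Finset.subset_singleton_iff.1 hI).resolve_left hIne.ne_empty
  obtain rfl : c = 1 := by simp at hc; omega
  have hv'0 : Γ.weight v' = 0 := by simpa [hu0.1] using hv
  have := H.good_of_le (ss := 0) (v := v' + Γ.shift 1 (u 0)) (b := {x} + {y}) rfl (by simp)
    (by rw [weight_add, weight_shift, hu0.1, hv'0]; simp) (by simpa using hd')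
    (add_le_add (by simpa using hx) (by simpa using hy))
    ⟨by rw [weight_add]; simp [weight, hxa, hya], by simp⟩ (by simp; omega)
  simpa using this

theorem good_of_mid [hp : Fact p.Prime] (hm : 3 ≤ m) (hd : (m - 2) * (p + 1) + 4 * p < 2 * d)
    (w : Multiset L) (hw : Γ.weight w = 0) (hwd : w.card = d) : Γ.Good w := by
  have hp3 := Γ.le_of_prime
  obtain ⟨h, hh⟩ : ∃ h, p + 1 = 2 * h := by
    rcases hp.out.eq_two_or_odd' with h | ⟨r, hr⟩
    · omega
    · exact ⟨r + 1, by omega⟩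
  obtain ⟨r, rfl⟩ := Nat.exists_eq_add_of_le hm
  have hd' : (r + 1) * h + 2 * p < d := by
    rw [hh] at hd
    have : 3 + r - 2 = r + 1 := by omega
    rw [this] at hd
    nlinarith
  refine Γ.good_of_parameters (by omega) (h := h) (k := 2) (n := 2) (by omega) (by omega) (by omega)
    (by simp [Finset.sum_range_succ]) le_rfl (by nlinarith) (by nlinarith) ?_ w hw hwd
  intro t ht c hc hdc
  by_contra! hlt
  have hlt' : c + h ≤ 3 * p - 2 := by omega
  rcases (by omega : t = r + 2 ∨ t = r + 1 ∨ t ≤ r) with rfl | rfl | ht'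
  · have : 3 + r - (r + 2) = 1 := by omega
    rw [this] at hc
    nlinarith
  · have : 3 + r - (r + 1) = 2 := by omega
    rw [this] at hc
    nlinarith
  · have := Nat.mul_le_mul_right h ht'
    have h3 : (r + 1) * h = r * h + h := by ring
    omega

theorem good_of_large [hp : Fact p.Prime] (hm : 0 < m) {k n : ℕ} (hk : 2 ≤ k)
    (hn : ∑ i ∈ Finset.range k, i ^ 2 < n)
    (hd : m * (p / k + 1) + p + (k - 1) * (n * p) < d)
    (w : Multiset L) (hw : Γ.weight w = 0) (hwd : w.card = d) : Γ.Good w := by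
  have hp2 := hp.out.two_le
  have hn2 : 2 ≤ n := by
    have := Finset.single_le_sum (f := fun i => i ^ 2) (fun _ _ => Nat.zero_le _)
      (Finset.mem_range.2 (show 1 < k by omega))
    omega
  have hk1 : n * p ≤ (k - 1) * (n * p) := Nat.le_mul_of_pos_left _ (by omega)
  have hdiv : p / k ≤ p / 2 := Nat.div_le_div_left hk two_pos
  have hdiv0 : 0 ≤ p / k := Nat.zero_le _
  refine Γ.good_of_parameters hm (h := p / k + 1) (k := k) (n := n) (by omega) (by omega)
    (Nat.lt_mul_div_succ p (by omega)).le hn hn2 (by omega) (by omega) ?_ w hw hwd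
  intro t ht c hc hdc
  by_contra! hlt
  have h1 := Nat.mul_le_mul_right (p / k + 1) ht.le
  have h2 : (k - 1) * (n * p - 1 - (p / k + 1)) ≤ (k - 1) * (n * p) :=
    Nat.mul_le_mul_left _ (by omega)
  omega

/-- Words of weight zero and length `d > p * m ^ 0.9` are good. -/
theorem good_of_rpow_lt [hp : Fact p.Prime] (hm : 0 < m) (hd : (p : ℝ) * (m : ℝ) ^ (0.9 : ℝ) < d)
    (w : Multiset L) (hw : Γ.weight w = 0) (hwd : w.card = d) : Γ.Good w := by
  have hpm := Γ.le_of_prime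
  have hpR : (0 : ℝ) < p := by exact_mod_cast hp.out.pos
  have hpmR : (m : ℝ) + 1 ≤ p := by exact_mod_cast hpm
  have key : ∀ x : ℝ, x ^ 10 ≤ (m : ℝ) ^ 9 → p * x < d := fun x hx =>
    (mul_le_mul_of_nonneg_left (le_rpow_nine_tenths (Nat.cast_nonneg m) hx) hpR.le).trans_lt hd
  rcases (by omega : m = 1 ∨ m = 2 ∨ 3 ≤ m) with rfl | rfl | h3
  · have hdp : p < d := by
      have := key 1 (by norm_num)
      rw [mul_one] at this
      exact_mod_cast this
    refine Γ.good_of_step one_pos 1 (by omega) (fun t ht H ss v hss hz hv hd hlong hdt hle => ?_)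
      w hw hwd
    obtain rfl : t = 0 := by omega
    omega
  · refine Γ.good_of_two ?_ w hw hwd
    have := key 1.8 (by norm_num)
    have h2 : (3 * p + 1 : ℝ) < 2 * d := by push_cast at hpmR; linarith
    exact_mod_cast h2
  by_cases h800 : m < 800
  · refine Γ.good_of_mid h3 ?_ w hw hwd
    obtain ⟨r, rfl⟩ := Nat.exists_eq_add_of_le h3
    have : 3 + r - 2 = r + 1 := by omega
    rw [this]
    suffices h : ((r + 1) * (p + 1) + 4 * p : ℝ) < 2 * d by exact_mod_cast h
    push_cast at *
    rcases (by omega : r = 0 ∨ r = 1 ∨ 5 ≤ 3 + r) with rfl | rfl | h5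
    · have := key 2.65 (by norm_num)
      push_cast at *
      linarith
    · have := key 3.3 (by norm_num)
      push_cast at *
      linarith
    · have h10 := add_three_pow_ten_le _ h5 h800
      have h10' : ((3 + r + 3 : ℕ) : ℝ) ^ 10 ≤ 1024 * ((3 + r : ℕ) : ℝ) ^ 9 := by exact_mod_cast h10
      have := key ((3 + r + 3) / 2) (by
        rw [div_pow, div_le_iff₀ (by norm_num)]
        push_cast at h10'
        linarith)
      nlinarith
  · push Not at h800
    have h800R : (800 : ℝ) ≤ m := by exact_mod_cast h800
    set y : ℝ := (m : ℝ) ^ (0.1 : ℝ) with hy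
    have hy0 : 0 ≤ y := Real.rpow_nonneg (Nat.cast_nonneg m) _
    have hy10 : y ^ 10 = m := by
      rw [hy, ← Real.rpow_natCast, ← Real.rpow_mul (Nat.cast_nonneg m)]
      norm_num
    have hy9 : (y ^ 9) ^ 10 ≤ (m : ℝ) ^ 9 := by rw [← hy10]; exact le_of_eq (by ring)
    have hy195 : 1.95 ≤ y := by
      refine le_of_pow_le_pow_left₀ (n := 10) (by norm_num) hy0 ?_
      rw [hy10]
      norm_num
      linarith
    have hz : 3.8 ≤ y ^ 2 := by nlinarith
    obtain ⟨k, hk⟩ : ∃ k, ⌈y ^ 2⌉₊ = k + 1 :=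
      Nat.exists_eq_succ_of_ne_zero (Nat.ceil_pos.2 (by positivity)).ne'
    have hkz : (k : ℝ) ≤ y ^ 2 := by
      have := Nat.ceil_lt_add_one (show 0 ≤ y ^ 2 by positivity)
      rw [hk] at this
      push_cast at this
      linarith
    have hzk : y ^ 2 ≤ (k : ℝ) + 1 := by
      have := Nat.le_ceil (y ^ 2)
      rw [hk] at this
      exact_mod_cast this
    have hk1 : 2 ≤ k + 1 := by
      have : (1 : ℝ) < k + 1 := by linarith
      have : 1 < k + 1 := by exact_mod_cast this
      omega
    refine Γ.good_of_large hm hk1 (Nat.lt_succ_self _) ?_ w hw hwd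
    rw [Nat.add_sub_cancel]
    suffices h : (m * ((p / (k + 1) : ℕ) + 1) + p
        + k * (((∑ i ∈ Finset.range (k + 1), i ^ 2 : ℕ) + 1) * p) : ℝ) < d by exact_mod_cast h
    refine lt_of_le_of_lt ?_ (key _ hy9)
    rw [sum_range_sq]
    have hdiv : (m : ℝ) * (p / (k + 1) : ℕ) ≤ p * y ^ 8 := by
      have h1 : ((p / (k + 1) : ℕ) : ℝ) ≤ p / (k + 1) := by exact_mod_cast Nat.cast_div_le
      have h2 : (p : ℝ) / (k + 1) ≤ p / y ^ 2 :=
        div_le_div_of_nonneg_left hpR.le (by positivity) hzk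
      calc (m : ℝ) * (p / (k + 1) : ℕ) ≤ m * (p / y ^ 2) :=
            mul_le_mul_of_nonneg_left (h1.trans h2) (Nat.cast_nonneg m)
        _ = p * y ^ 8 := by
          rw [← hy10]
          have : y ≠ 0 := by rintro h; rw [h] at hy195; norm_num at hy195
          field_simp
    have hk0 : (0 : ℝ) ≤ k := Nat.cast_nonneg k
    have hcube : (k : ℝ) * (k * (k + 1) * (2 * k + 1) / 6 + 1)
        ≤ y ^ 2 * (y ^ 2 * (y ^ 2 + 1) * (2 * y ^ 2 + 1) / 6 + 1) := by gcongr
    have hpoly : y ^ 8 + 2 + y ^ 2 * (y ^ 2 * (y ^ 2 + 1) * (2 * y ^ 2 + 1) / 6 + 1) ≤ y ^ 9 := by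
      have h1 : 1.95 * y ^ 8 ≤ y ^ 9 := by
        rw [pow_succ y 8, mul_comm]
        exact mul_le_mul_of_nonneg_left hy195 (by positivity)
      have h4 : y ^ 8 = (y ^ 2) ^ 4 := by ring
      rw [h4] at h1 ⊢
      set z := y ^ 2
      have e2 : 3.8 * z ≤ z ^ 2 := by nlinarith
      have e3 : 3.8 * z ^ 2 ≤ z ^ 3 := by nlinarith [sq_nonneg z]
      have e4 : 3.8 * z ^ 3 ≤ z ^ 4 := by nlinarith [pow_nonneg (by linarith : 0 ≤ z) 3]
      nlinarith
    have hfin := mul_le_mul_of_nonneg_left (add_le_add_right hcube (y ^ 8 + 2)) hpR.le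
    have hfin' := mul_le_mul_of_nonneg_left hpoly hpR.le
    nlinarith

end SwapSystem

namespace Representation

open MvPolynomial

variable {G : Type*} [Group G] {n : ℕ} (ρ : Representation ℂ G (Fin n → ℂ))

theorem polySubst_X (g : G) (i : Fin n) :
    ρ.polySubst g (X i) = ∑ j, C (LinearMap.toMatrix' (ρ g) i j) * X j := by
  simp [polySubst]

theorem polySubst_polySubst (g h : G) (f : MvPolynomial (Fin n) ℂ) :
    ρ.polySubst g (ρ.polySubst h f) = ρ.polySubst (h * g) f := by
  suffices H : (ρ.polySubst g).comp (ρ.polySubst h) = ρ.polySubst (h * g) from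
    DFunLike.congr_fun H f
  refine MvPolynomial.algHom_ext fun i => ?_
  simp only [AlgHom.comp_apply, polySubst_X, map_sum, map_mul, algHom_C, algebraMap_eq,
    Finset.mul_sum]
  rw [Finset.sum_comm]
  refine Finset.sum_congr rfl fun k _ => ?_
  rw [LinearMap.toMatrix'_mul, Matrix.mul_apply, map_sum, Finset.sum_mul]
  exact Finset.sum_congr rfl fun j _ => by rw [map_mul, mul_assoc]

@[simp] theorem polySubst_one (f : MvPolynomial (Fin n) ℂ) : ρ.polySubst 1 f = f := by
  have : ρ.polySubst 1 = AlgHom.id ℂ _ := by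
    refine MvPolynomial.algHom_ext fun i => ?_
    rw [polySubst_X, map_one, LinearMap.toMatrix'_one, Finset.sum_eq_single i]
    · simp
    · intro j _ hj
      simp [Matrix.one_apply_ne hj.symm]
    · simp
  rw [this, AlgHom.id_apply]

theorem isHomogeneous_polySubst (g : G) {f : MvPolynomial (Fin n) ℂ} {d : ℕ}
    (hf : f.IsHomogeneous d) : (ρ.polySubst g f).IsHomogeneous d := by
  have := hf.aeval (g := fun i => ∑ j, C (LinearMap.toMatrix' (ρ g) i j) * X j) (n := 1)
    fun i => IsHomogeneous.sum _ _ _ fun j _ => by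
      simpa using (isHomogeneous_C _ _).mul (isHomogeneous_X ℂ j)
  simpa [polySubst] using this

theorem mem_invariantAlgebra {f : MvPolynomial (Fin n) ℂ} :
    f ∈ ρ.invariantAlgebra ↔ ∀ g, ρ.polySubst g f = f := by
  simp [invariantAlgebra, Algebra.mem_iInf, AlgHom.mem_equalizer]

theorem homogeneousComponent_polySubst (g : G) (e : ℕ) (f : MvPolynomial (Fin n) ℂ) :
    homogeneousComponent e (ρ.polySubst g f) = ρ.polySubst g (homogeneousComponent e f) := by
  have h : ∀ i, homogeneousComponent e (ρ.polySubst g (homogeneousComponent i f))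
      = if e = i then ρ.polySubst g (homogeneousComponent i f) else 0 := fun i =>
    homogeneousComponent_of_mem (ρ.isHomogeneous_polySubst g (homogeneousComponent_isHomogeneous i f))
  conv_lhs => rw [← sum_homogeneousComponent f, map_sum, map_sum]
  simp_rw [h]
  rw [Finset.sum_ite_eq]
  split_ifs with he
  · rfl
  · rw [homogeneousComponent_eq_zero, map_zero]
    simpa using he

/-- The sum of all translates of a polynomial. -/
noncomputable def orbitSum [Fintype G] : MvPolynomial (Fin n) ℂ →ₗ[ℂ] MvPolynomial (Fin n) ℂ :=
  ∑ g : G, (ρ.polySubst g).toLinearMap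

theorem orbitSum_apply [Fintype G] (f : MvPolynomial (Fin n) ℂ) :
    ρ.orbitSum f = ∑ g : G, ρ.polySubst g f := by
  simp [orbitSum]

theorem orbitSum_polySubst [Fintype G] (h : G) (f : MvPolynomial (Fin n) ℂ) :
    ρ.orbitSum (ρ.polySubst h f) = ρ.orbitSum f := by
  simp only [orbitSum_apply, polySubst_polySubst]
  exact Fintype.sum_equiv (Equiv.mulLeft h) _ _ fun g => rfl

theorem polySubst_orbitSum [Fintype G] (h : G) (f : MvPolynomial (Fin n) ℂ) :
    ρ.polySubst h (ρ.orbitSum f) = ρ.orbitSum f := by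
  simp only [orbitSum_apply, map_sum, polySubst_polySubst]
  exact Fintype.sum_equiv (Equiv.mulRight h) _ _ fun g => rfl

theorem orbitSum_mul [Fintype G] {q : MvPolynomial (Fin n) ℂ} (hq : ∀ g, ρ.polySubst g q = q)
    (f : MvPolynomial (Fin n) ℂ) : ρ.orbitSum (q * f) = q * ρ.orbitSum f := by
  simp only [orbitSum_apply, map_mul, hq, Finset.mul_sum]

theorem orbitSum_of_invariant [Fintype G] {q : MvPolynomial (Fin n) ℂ}
    (hq : ∀ g, ρ.polySubst g q = q) : ρ.orbitSum q = (Fintype.card G : ℂ) • q := by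
  simp [orbitSum_apply, hq, Nat.cast_smul_eq_nsmul]

theorem isHomogeneous_orbitSum [Fintype G] {f : MvPolynomial (Fin n) ℂ} {d : ℕ}
    (hf : f.IsHomogeneous d) : (ρ.orbitSum f).IsHomogeneous d := by
  rw [orbitSum_apply]
  exact IsHomogeneous.sum _ _ _ fun g _ => ρ.isHomogeneous_polySubst g hf

/-- Linear forms that are eigenvectors of `a`, together with their weight in `ℤ/p`. -/
abbrev EigenForm (p : ℕ) [NeZero p] (a : G) : Type :=
  {x : ZMod p × MvPolynomial (Fin n) ℂ //
    x.2.IsHomogeneous 1 ∧ ρ.polySubst a x.2 = ZMod.stdAddChar x.1 • x.2}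

namespace EigenForm

variable {ρ} {p : ℕ} [NeZero p] {a : G}

/-- The value of a word of eigenforms. -/
noncomputable def prod (w : Multiset (ρ.EigenForm p a)) : MvPolynomial (Fin n) ℂ :=
  (w.map fun x => x.1.2).prod

theorem prod_add (v w : Multiset (ρ.EigenForm p a)) : prod (v + w) = prod v * prod w := by
  simp [prod]

theorem isHomogeneous_prod (w : Multiset (ρ.EigenForm p a)) : (prod w).IsHomogeneous w.card := by
  induction w using Multiset.induction_on with
  | empty => simpa [prod] using isHomogeneous_one _ _
  | cons x w ih =>
    rw [Multiset.card_cons, add_comm, ← Multiset.singleton_add, prod_add]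
    refine IsHomogeneous.mul ?_ ih
    simpa [prod] using x.2.1

theorem polySubst_prod (w : Multiset (ρ.EigenForm p a)) :
    ρ.polySubst a (prod w) = ZMod.stdAddChar (w.map fun x => x.1.1).sum • prod w := by
  induction w using Multiset.induction_on with
  | empty => simp [prod]
  | cons x w ih =>
    rw [← Multiset.singleton_add, prod_add, map_mul, ih, Multiset.map_add, Multiset.sum_add,
      AddChar.map_add_eq_mul]
    have : ρ.polySubst a (prod {x}) = ZMod.stdAddChar x.1.1 • prod {x} := by
      simpa [prod] using x.2.2
    rw [this]
    rw [smul_mul_smul_comm, Multiset.map_singleton, Multiset.sum_singleton]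

theorem polySubst_pow_prod {w : Multiset (ρ.EigenForm p a)}
    (hw : (w.map fun x => x.1.1).sum = 0) (k : ℕ) : ρ.polySubst (a ^ k) (prod w) = prod w := by
  induction k with
  | zero => simp
  | succ k ih => rw [pow_succ, ← polySubst_polySubst, ih, polySubst_prod, hw]; simp

theorem orbitSum_prod_eq_zero [Fintype G] {w : Multiset (ρ.EigenForm p a)}
    (hw : (w.map fun x => x.1.1).sum ≠ 0) : ρ.orbitSum (prod w) = 0 := by
  have h := ρ.orbitSum_polySubst a (prod w)
  rw [polySubst_prod, map_smul, ← sub_eq_zero] at h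
  nth_rewrite 2 [← one_smul ℂ (ρ.orbitSum (prod w))] at h
  rw [← sub_smul] at h
  refine (smul_eq_zero.1 h).resolve_left fun h1 => hw ?_
  refine ZMod.injective_stdAddChar ?_
  rw [AddChar.map_zero_eq_one]
  exact sub_eq_zero.1 h1

theorem mem_span_X (ha : a ^ p = 1) (i : Fin n) :
    (X i : MvPolynomial (Fin n) ℂ) ∈
      Submodule.span ℂ {f | ∃ w : Multiset (ρ.EigenForm p a), w.card = 1 ∧ prod w = f} := by
  let ψ : ZMod p → MvPolynomial (Fin n) ℂ := fun k => ρ.polySubst (a ^ k.val) (X i)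
  have hψ : ∀ k, ρ.polySubst a (ψ k) = ψ (k + 1) := by
    intro k
    have h1 : a ^ (k + 1).val = a ^ k.val * a := by
      rw [← pow_succ, pow_eq_pow_mod _ ha, pow_eq_pow_mod (k.val + 1) ha, ZMod.val_add,
        ZMod.val_one_eq_one_mod]
      simp
    simp only [ψ, polySubst_polySubst, h1]
  let f : ZMod p → MvPolynomial (Fin n) ℂ := fun c => ∑ k, ZMod.stdAddChar (-(k * c)) • ψ k
  have hf : ∀ c, (f c).IsHomogeneous 1 ∧ ρ.polySubst a (f c) = ZMod.stdAddChar c • f c := by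
    intro c
    constructor
    · refine IsHomogeneous.sum _ _ _ fun k _ => ?_
      rw [smul_eq_C_mul]
      simpa using (isHomogeneous_C _ _).mul (ρ.isHomogeneous_polySubst _ (isHomogeneous_X ℂ i))
    · simp only [f, map_sum, map_smul, hψ, Finset.smul_sum, smul_smul, ← AddChar.map_add_eq_mul]
      refine Fintype.sum_equiv (Equiv.addRight 1) _ _ fun k => ?_
      congr 2
      simp only [Equiv.coe_addRight]
      ring
  have hsum : ∑ c, f c = (p : ℂ) • X i := by
    simp only [f]
    rw [Finset.sum_comm]
    have : ∀ k : ZMod p, ∑ c : ZMod p, ZMod.stdAddChar (-(k * c)) • ψ k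
        = if k = 0 then (p : ℂ) • ψ 0 else 0 := by
      intro k
      rw [← Finset.sum_smul]
      have := AddChar.sum_mulShift (-k) (ZMod.isPrimitive_stdAddChar p)
      rw [ZMod.card] at this
      have h2 : ∑ c : ZMod p, ZMod.stdAddChar (-(k * c)) = if k = 0 then (p : ℂ) else 0 := by
        have h3 : (if k = 0 then (p : ℂ) else 0) = ((if -k = 0 then p else 0 : ℕ) : ℂ) := by
          simp
        rw [h3, ← this]
        refine Finset.sum_congr rfl fun c _ => by congr 1; ring
      rw [h2]
      split_ifs with h
      · rw [h]
      · simp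
    rw [Finset.sum_congr rfl fun k _ => this k, Finset.sum_ite_eq' Finset.univ, if_pos (by simp)]
    simp [ψ]
  have hp : (p : ℂ) ≠ 0 := Nat.cast_ne_zero.2 (NeZero.ne p)
  refine (Submodule.smul_mem_iff _ hp).1 ?_
  rw [← hsum]
  refine Submodule.sum_mem _ fun c _ => Submodule.subset_span ⟨{⟨(c, f c), hf c⟩}, by simp, ?_⟩
  simp [prod]

theorem mem_span_prod (ha : a ^ p = 1) {f : MvPolynomial (Fin n) ℂ} {d : ℕ}
    (hf : f.IsHomogeneous d) :
    f ∈ Submodule.span ℂ {f | ∃ w : Multiset (ρ.EigenForm p a), w.card = d ∧ prod w = f} := by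
  have key : ∀ t : Multiset (Fin n), (t.map X).prod ∈ Submodule.span ℂ
      {f | ∃ w : Multiset (ρ.EigenForm p a), w.card = t.card ∧ prod w = f} := by
    intro t
    induction t using Multiset.induction_on with
    | empty => exact Submodule.subset_span ⟨0, rfl, by simp [prod]⟩
    | cons i t ih =>
      rw [Multiset.map_cons, Multiset.prod_cons]
      have := Submodule.mul_mem_mul (mem_span_X (ρ := ρ) ha i) ih
      rw [Submodule.span_mul_span] at this
      refine Submodule.span_mono ?_ this
      rintro _ ⟨_, ⟨v, hv, rfl⟩, _, ⟨w, hw, rfl⟩, rfl⟩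
      exact ⟨v + w, by simp [hv, hw, add_comm], prod_add v w⟩
  rw [f.as_sum]
  refine Submodule.sum_mem _ fun s hs => ?_
  have h1 := key (Finsupp.toMultiset s)
  have h2 : (Finsupp.toMultiset s).card = d := by
    rw [Finsupp.card_toMultiset, ← hf (mem_support_iff.1 hs)]
    simp [Finsupp.weight_apply, Finsupp.sum]
  rw [h2] at h1
  have h3 : monomial s (coeff s f) = coeff s f • ((Finsupp.toMultiset s).map X).prod := by
    rw [monomial_eq, smul_eq_C_mul, Finsupp.toMultiset_map, Finsupp.prod_toMultiset]
    rw [Finsupp.prod_mapDomain_index (by simp) fun _ _ _ => pow_add _ _ _]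
  rw [h3]
  exact Submodule.smul_mem _ _ h1

end EigenForm

end Representation

namespace Representation

open MvPolynomial

variable {G : Type*} [Group G] {n : ℕ} (ρ : Representation ℂ G (Fin n → ℂ))

/-- The subalgebra generated by the invariants of degree at most `B`. -/
noncomputable def lowDegreeAlgebra (B : ℕ) : Subalgebra ℂ (MvPolynomial (Fin n) ℂ) :=
  Algebra.adjoin ℂ {f : MvPolynomial (Fin n) ℂ | f ∈ ρ.invariantAlgebra ∧ f.totalDegree ≤ B}

namespace EigenForm

variable {ρ} {p : ℕ} [NeZero p] {a : G}

/-- Substitution by an element `g` that normalizes the subgroup generated by `a`. -/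
noncomputable def twist {g : G} {l : ℕ} (hg : g * a = a ^ l * g) (x : ρ.EigenForm p a) :
    ρ.EigenForm p a :=
  ⟨((l : ZMod p) * x.1.1, ρ.polySubst g x.1.2), ρ.isHomogeneous_polySubst g x.2.1, by
    have h : ∀ l : ℕ, ρ.polySubst (a ^ l) x.1.2
        = ZMod.stdAddChar ((l : ZMod p) * x.1.1) • x.1.2 := by
      intro l
      induction l with
      | zero => simp
      | succ l ih =>
        rw [pow_succ, ← polySubst_polySubst, ih, map_smul, x.2.2, smul_smul,
          ← AddChar.map_add_eq_mul]
        congr 2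
        push_cast
        ring
    simp only
    rw [polySubst_polySubst, hg, ← polySubst_polySubst, h, map_smul]⟩

theorem iterate_twist {g : G} {l : ℕ} (hg : g * a = a ^ l * g) (i : ℕ) (x : ρ.EigenForm p a) :
    ((twist hg)^[i] x).1.2 = ρ.polySubst (g ^ i) x.1.2 := by
  induction i with
  | zero => simp
  | succ i ih =>
    rw [Function.iterate_succ_apply', pow_succ, ← polySubst_polySubst, ← ih]
    rfl

theorem prod_map_iterate_twist {g : G} {l : ℕ} (hg : g * a = a ^ l * g) (i : ℕ)
    (w : Multiset (ρ.EigenForm p a)) :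
    ((w.map (twist hg)^[i]).map fun x => x.1.2).prod = ρ.polySubst (g ^ i) (prod w) := by
  rw [Multiset.map_map, prod, map_multiset_prod, Multiset.map_map]
  congr 1
  exact Multiset.map_congr rfl fun x _ => iterate_twist hg i x

end EigenForm

/-- If `a ^ k * g ^ i` represents every group element and `g ^ m` is a power of `a`, then the sum
of the first `m` translates under powers of `g` of a polynomial fixed by `a` is invariant. -/
theorem polySubst_sum_pow {a g : G} {l m : ℕ} (hg : g * a = a ^ l * g)
    (hgm : ∃ k, g ^ m = a ^ k) (hgen : ∀ x : G, ∃ k i, x = a ^ k * g ^ i)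
    {q : MvPolynomial (Fin n) ℂ} (hq : ∀ k, ρ.polySubst (a ^ k) q = q) (x : G) :
    ρ.polySubst x (∑ i ∈ Finset.range m, ρ.polySubst (g ^ i) q)
      = ∑ i ∈ Finset.range m, ρ.polySubst (g ^ i) q := by
  have hconj : ∀ i k, ∃ k', g ^ i * a ^ k = a ^ k' * g ^ i := by
    have h1 : ∀ k, g * a ^ k = a ^ (l * k) * g := fun k => by
      have : SemiconjBy g a (a ^ l) := hg
      simpa [pow_mul] using (this.pow_right k).eq
    intro i
    induction i with
    | zero => exact fun k => ⟨k, by simp⟩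
    | succ i ih =>
      intro k
      obtain ⟨k', hk'⟩ := ih (l * k)
      exact ⟨k', by rw [pow_succ, mul_assoc, h1, ← mul_assoc, hk', mul_assoc]⟩
  have ha : ∀ k, ρ.polySubst (a ^ k) (∑ i ∈ Finset.range m, ρ.polySubst (g ^ i) q)
      = ∑ i ∈ Finset.range m, ρ.polySubst (g ^ i) q := by
    intro k
    rw [map_sum]
    refine Finset.sum_congr rfl fun i _ => ?_
    obtain ⟨k', hk'⟩ := hconj i k
    rw [polySubst_polySubst, hk', ← polySubst_polySubst, hq]
  have h1 : ρ.polySubst g (∑ i ∈ Finset.range m, ρ.polySubst (g ^ i) q)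
      = ∑ i ∈ Finset.range m, ρ.polySubst (g ^ i) q := by
    rw [map_sum]
    simp only [polySubst_polySubst, ← pow_succ]
    have h2 := Finset.sum_range_succ (fun i => ρ.polySubst (g ^ i) q) m
    rw [Finset.sum_range_succ'] at h2
    obtain ⟨k, hk⟩ := hgm
    rw [hk, hq, pow_zero, polySubst_one] at h2
    exact add_right_cancel h2
  obtain ⟨k, i, rfl⟩ := hgen x
  rw [← polySubst_polySubst, ha]
  induction i with
  | zero => simp
  | succ i ih => rw [pow_succ, ← polySubst_polySubst, ih, h1]

/-- The swap system of eigenforms of `a`, where `W` consists of the polynomials whose orbit sum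
is generated in degree at most `B`. -/
noncomputable def swapSystem [Fintype G] {p m d B : ℕ} [NeZero p] {a g : G} {l : ℕ}
    (hg : g * a = a ^ l * g) (hgm : ∃ k, g ^ m = a ^ k) (hgen : ∀ x : G, ∃ k i, x = a ^ k * g ^ i)
    (hlm : (l : ZMod p) ^ m = 1)
    (hlinj : ∀ i < m, ∀ j < m, (l : ZMod p) ^ i = (l : ZMod p) ^ j → i = j)
    (ih : ∀ e < d, ∀ f : MvPolynomial (Fin n) ℂ, f.IsHomogeneous e →
      (∀ x, ρ.polySubst x f = f) → f ∈ ρ.lowDegreeAlgebra B) :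
    SwapSystem p m d (ρ.EigenForm p a) (MvPolynomial (Fin n) ℂ) where
  wt x := x.1.1
  ev x := x.1.2
  γ := EigenForm.twist hg
  lam := l
  wt_γ _ := rfl
  lam_pow := hlm
  lam_inj := hlinj
  W := (Subalgebra.toSubmodule (ρ.lowDegreeAlgebra B)).comap ρ.orbitSum
  period b hb := by
    obtain ⟨k, hk⟩ := hgm
    rw [EigenForm.prod_map_iterate_twist, hk, EigenForm.polySubst_pow_prod hb]
    rfl
  trace b s hb hb0 hs0 hd := by
    have hbc := Multiset.card_pos.2 hb0
    have hsc := Multiset.card_pos.2 hs0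
    simp only [EigenForm.prod_map_iterate_twist]
    have hinv := ρ.polySubst_sum_pow hg hgm hgen fun k => EigenForm.polySubst_pow_prod hb k
    rw [Submodule.mem_comap, ρ.orbitSum_mul hinv]
    refine Subalgebra.mul_mem _ (ih b.card (by omega) _ ?_ hinv)
      (ih s.card (by omega) _ ?_ fun x => ρ.polySubst_orbitSum x _)
    · exact IsHomogeneous.sum _ _ _ fun i _ =>
        ρ.isHomogeneous_polySubst _ (EigenForm.isHomogeneous_prod b)
    · exact ρ.isHomogeneous_orbitSum (EigenForm.isHomogeneous_prod s)

theorem mem_lowDegreeAlgebra_of_isHomogeneous [Fintype G] {p m B : ℕ} [hp : Fact p.Prime]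
    (hm : 0 < m) {a g : G} {l : ℕ} (ha : a ^ p = 1)
    (hg : g * a = a ^ l * g) (hgm : ∃ k, g ^ m = a ^ k) (hgen : ∀ x : G, ∃ k i, x = a ^ k * g ^ i)
    (hlm : (l : ZMod p) ^ m = 1)
    (hlinj : ∀ i < m, ∀ j < m, (l : ZMod p) ^ i = (l : ZMod p) ^ j → i = j)
    (hB : (p : ℝ) * (m : ℝ) ^ (0.9 : ℝ) < B + 1) (d : ℕ) (f : MvPolynomial (Fin n) ℂ)
    (hf : f.IsHomogeneous d) (hinv : ∀ x, ρ.polySubst x f = f) : f ∈ ρ.lowDegreeAlgebra B := by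
  induction d using Nat.strong_induction_on generalizing f with
  | _ d ih =>
    by_cases hd : d ≤ B
    · exact Algebra.subset_adjoin ⟨ρ.mem_invariantAlgebra.2 hinv, hf.totalDegree_le.trans hd⟩
    have hcard : (Fintype.card G : ℂ) ≠ 0 := Nat.cast_ne_zero.2 Fintype.card_ne_zero
    suffices h : ρ.orbitSum f ∈ Subalgebra.toSubmodule (ρ.lowDegreeAlgebra B) by
      rw [ρ.orbitSum_of_invariant hinv] at h
      exact (Submodule.smul_mem_iff _ hcard).1 h
    suffices h : Submodule.span ℂ
        {f | ∃ w : Multiset (ρ.EigenForm p a), w.card = d ∧ EigenForm.prod w = f}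
        ≤ (Subalgebra.toSubmodule (ρ.lowDegreeAlgebra B)).comap ρ.orbitSum from
      h (EigenForm.mem_span_prod ha hf)
    rw [Submodule.span_le]
    rintro _ ⟨w, hw, rfl⟩
    by_cases hw0 : (w.map fun x => x.1.1).sum = 0
    · refine (ρ.swapSystem hg hgm hgen hlm hlinj ih).good_of_rpow_lt hm (hB.trans_le ?_) w hw0 hw
      exact_mod_cast not_le.1 hd
    · change ρ.orbitSum _ ∈ ρ.lowDegreeAlgebra B
      rw [EigenForm.orbitSum_prod_eq_zero hw0]
      exact Subalgebra.zero_mem _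

theorem invariantsGeneratedInDegree_of_isHomogeneous {B : ℕ}
    (h : ∀ (d : ℕ) (f : MvPolynomial (Fin n) ℂ), f.IsHomogeneous d →
      (∀ x, ρ.polySubst x f = f) → f ∈ ρ.lowDegreeAlgebra B) :
    ρ.InvariantsGeneratedInDegree B := by
  refine le_antisymm (Algebra.adjoin_le fun f hf => hf.1) fun f hf => ?_
  rw [mem_invariantAlgebra] at hf
  rw [← sum_homogeneousComponent f]
  refine Subalgebra.sum_mem _ fun i _ => h i _ (homogeneousComponent_isHomogeneous i f) fun x => ?_
  rw [← homogeneousComponent_polySubst, hf]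

end Representation

/-- Generators of a group with a self-centralizing normal subgroup of prime order and a cyclic
quotient, together with their relations. -/
theorem Subgroup.exists_generators_of_centralizer_eq {G : Type*} [Group G] [Finite G] {p m : ℕ}
    [hp : Fact p.Prime] (N : Subgroup G) [N.Normal] (hcardN : Nat.card N = p)
    (hcent : Subgroup.centralizer (N : Set G) = N) [IsCyclic (G ⧸ N)]
    (hcardQ : Nat.card (G ⧸ N) = m) :
    ∃ (a g : G) (l : ℕ), a ^ p = 1 ∧ g * a = a ^ l * g ∧ (∃ k, g ^ m = a ^ k) ∧
      (∀ x : G, ∃ k i, x = a ^ k * g ^ i) ∧ (l : ZMod p) ^ m = 1 ∧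
      ∀ i < m, ∀ j < m, (l : ZMod p) ^ i = (l : ZMod p) ^ j → i = j := by
  have : IsCyclic N := isCyclic_of_prime_card hcardN
  obtain ⟨⟨a, haN⟩, ha⟩ := IsCyclic.exists_generator (α := N)
  obtain ⟨g', hg'⟩ := IsCyclic.exists_generator (α := G ⧸ N)
  obtain ⟨g, rfl⟩ := QuotientGroup.mk_surjective g'
  have hpow : ∀ x ∈ N, ∃ k : ℕ, x = a ^ k := fun x hx => by
    obtain ⟨k, hk⟩ := (mem_powers_iff_mem_zpowers.2 (ha ⟨x, hx⟩))
    exact ⟨k, (congrArg Subtype.val hk).symm⟩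
  have horda : orderOf a = p := by
    rw [← hcardN, ← orderOf_eq_card_of_forall_mem_zpowers ha, Subgroup.orderOf_mk]
  have hordg : orderOf (g : G ⧸ N) = m := by
    rw [← hcardQ, orderOf_eq_card_of_forall_mem_zpowers hg']
  obtain ⟨l, hl⟩ := hpow _ (Subgroup.Normal.conj_mem ‹_› a haN g)
  have hga : g * a = a ^ l * g := by rw [← hl]; group
  have hgi : ∀ i : ℕ, g ^ i * a = a ^ l ^ i * g ^ i := by
    intro i
    induction i with
    | zero => simp
    | succ i ih =>
      have h1 : SemiconjBy g a (a ^ l) := hga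
      have h2 := (h1.pow_right (l ^ i)).eq
      rw [pow_succ', mul_assoc, ih, ← mul_assoc, h2, ← pow_mul, pow_succ', mul_assoc]
  have hpow_eq : ∀ s t : ℕ, a ^ s = a ^ t ↔ (s : ZMod p) = t := fun s t => by
    rw [pow_eq_pow_iff_modEq, horda, ZMod.natCast_eq_natCast_iff]
  have hcomm : ∀ x ∈ N, x * a = a * x := fun x hx => by
    obtain ⟨k, rfl⟩ := hpow x hx
    exact (pow_mul_comm' a k)
  have hgm : g ^ m ∈ N := by
    rw [← QuotientGroup.eq_one_iff, QuotientGroup.mk_pow, ← hordg, pow_orderOf_eq_one]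
  have hlm : (l : ZMod p) ^ m = 1 := by
    have h1 := hgi m
    rw [hcomm _ hgm] at h1
    have h2 := mul_right_cancel h1
    have h3 := (hpow_eq 1 (l ^ m)).1 (by rw [pow_one, ← h2])
    push_cast at h3
    exact h3.symm
  refine ⟨a, g, l, horda ▸ pow_orderOf_eq_one a, hga, hpow _ hgm, fun x => ?_, hlm,
    fun i hi j hj hij => ?_⟩
  · obtain ⟨i, hi⟩ := mem_powers_iff_mem_zpowers.2 (hg' x)
    have hx : x * (g ^ i)⁻¹ ∈ N := by
      rw [← QuotientGroup.eq_one_iff, QuotientGroup.mk_mul, QuotientGroup.mk_inv,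
        QuotientGroup.mk_pow]
      simp only at hi
      rw [hi, mul_inv_cancel]
    obtain ⟨k, hk⟩ := hpow _ hx
    exact ⟨k, i, by rw [← hk]; group⟩
  · have hij' : a ^ l ^ i = a ^ l ^ j := (hpow_eq _ _).2 (by push_cast; exact hij)
    have hc : (g ^ i)⁻¹ * g ^ j ∈ N := by
      rw [← hcent, Subgroup.mem_centralizer_iff]
      intro x hx
      obtain ⟨k, rfl⟩ := hpow x hx
      have hca : Commute a ((g ^ i)⁻¹ * g ^ j) := by
        have h1 := hgi i
        have h2 := hgi j
        rw [hij', ← mul_inv_eq_iff_eq_mul] at h1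
        rw [← h1] at h2
        have h3 : g ^ j * a = g ^ i * (a * ((g ^ i)⁻¹ * g ^ j)) := by
          rw [h2]; group
        change a * ((g ^ i)⁻¹ * g ^ j) = (g ^ i)⁻¹ * g ^ j * a
        rw [mul_assoc, h3, inv_mul_cancel_left]
      exact (hca.pow_left k).eq
    have hq := QuotientGroup.eq.2 hc
    rw [QuotientGroup.mk_pow, QuotientGroup.mk_pow] at hq
    exact pow_injOn_Iio_orderOf (by simpa [hordg] using hi) (by simpa [hordg] using hj) hq

/-- **Corollary (p·m^0.9 bound).**  Let `N` be a normal subgroup of prime order `p`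
in a finite group `G` with `N = C_G(N)` and `G/N` cyclic of order `m` prime to `p`.
Then `β(G) ≤ p·m^0.9`. -/
theorem noetherNumber_le_of_affine
    (p m : ℕ) (hp : p.Prime)
    (G : Type) [Group G] [Finite G] (N : Subgroup G) (hN : N.Normal)
    (hcardN : Nat.card N = p)
    (hcent : Subgroup.centralizer (N : Set G) = N)
    (hcyc : IsCyclic (G ⧸ N)) (hcardQ : Nat.card (G ⧸ N) = m)
    (hcop : Nat.Coprime m p) :
    (noetherNumber G : ℝ) ≤ (p : ℝ) * (m : ℝ) ^ (0.9 : ℝ) := by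
  have := Fact.mk hp
  have := Fintype.ofFinite G
  have hm : 0 < m := hcardQ ▸ Nat.card_pos
  obtain ⟨a, g, l, ha, hg, hgm, hgen, hlm, hlinj⟩ :=
    N.exists_generators_of_centralizer_eq hcardN hcent hcardQ
  have hle : noetherNumber G ≤ ⌊(p : ℝ) * (m : ℝ) ^ (0.9 : ℝ)⌋₊ := Nat.sInf_le fun n ρ =>
    ρ.invariantsGeneratedInDegree_of_isHomogeneous fun d f hf hinv =>
      ρ.mem_lowDegreeAlgebra_of_isHomogeneous hm ha hg hgm hgen hlm hlinj (Nat.lt_floor_add_one _)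
        d f hf hinv
  exact (Nat.cast_le.2 hle).trans (Nat.floor_le (by positivity))
end

section
/- Let C be a characteristic cyclic subgroup of maximal order in a finite nilpotent group G. Then β(G) ≤ |C|^{0.2} · |G|^{0.8}. -/
theorem one_add_mul_pow_five_le {p k : ℕ} (hp : 2 ≤ p) (hk : 2 ≤ k) :
    (1 + k * (p - 1)) ^ 5 ≤ (p ^ k) ^ 4 := by
  obtain ⟨q, rfl⟩ := Nat.exists_eq_add_of_le hp
  rw [show 2 + q - 1 = 1 + q by omega]
  induction k, hk using Nat.le_induction with
  | base =>
    exact Nat.le.intro (k := 13 + 214 * q + 712 * q ^ 2 + 1072 * q ^ 3 + 880 * q ^ 4 +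
      416 * q ^ 5 + 112 * q ^ 6 + 16 * q ^ 7 + q ^ 8) (by ring)
  | succ k hk ih =>
    have h₁ : 2 * (1 + (k + 1) * (1 + q)) ≤ 3 * (1 + k * (1 + q)) := by nlinarith
    have h₂ := Nat.pow_le_pow_left h₁ 5
    have h₃ : 2 ^ 4 ≤ (2 + q) ^ 4 := Nat.pow_le_pow_left (by omega) 4
    rw [mul_pow, mul_pow] at h₂
    have h₄ : ((2 + q) ^ (k + 1)) ^ 4 = ((2 + q) ^ k) ^ 4 * (2 + q) ^ 4 := by ring
    have h₅ := Nat.mul_le_mul ih h₃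
    rw [h₄]
    omega

theorem isCyclic_of_isCyclic_abelianization (G : Type*) [Group G] [Finite G]
    [Group.IsNilpotent G] [IsCyclic (Abelianization G)] : IsCyclic G := by
  obtain ⟨y, hy⟩ := IsCyclic.exists_generator (α := Abelianization G)
  obtain ⟨x, rfl⟩ := QuotientGroup.mk_surjective y
  by_contra hG
  have hx : Subgroup.zpowers x ≠ ⊤ := fun h =>
    hG ⟨x, fun g => Subgroup.mem_zpowers_iff.mp (h ▸ Subgroup.mem_top g)⟩
  obtain ⟨M, hM, hxM⟩ := (eq_top_or_exists_le_coatom (Subgroup.zpowers x)).resolve_left hx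
  have hn : M.Normal := Subgroup.NormalizerCondition.normal_of_coatom M
    Group.normalizerCondition_of_isNilpotent hM
  have hc : commutator G ≤ M := by
    by_contra hc
    have htop : M ⊔ commutator G = ⊤ := hM.2 _ (by simpa using hc)
    have : Nontrivial (G ⧸ M) := QuotientGroup.nontrivial_iff.mpr hM.1
    refine (Group.IsSolvable.commutator_lt_top_of_nontrivial (G ⧸ M)).ne ?_
    have := congrArg (Subgroup.map (QuotientGroup.mk' M)) htop
    rwa [Subgroup.map_sup, QuotientGroup.map_mk'_self, bot_sup_eq, commutator_def,
      Subgroup.map_commutator,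
      Subgroup.map_top_of_surjective _ (QuotientGroup.mk'_surjective M),
      ← commutator_def] at this
  refine hM.1 (eq_top_iff.mpr fun g _ => ?_)
  obtain ⟨n, hn⟩ := hy (QuotientGroup.mk g)
  have : (x ^ n)⁻¹ * g ∈ commutator G := QuotientGroup.eq.mp hn
  have := M.mul_mem (M.zpow_mem (hxM (Subgroup.mem_zpowers x)) n) (hc this)
  simpa using this

theorem isCyclic_of_forall_prime_card_ker_pow_le (A : Type*) [CommGroup A] [Finite A]
    (h : ∀ p : ℕ, p.Prime → Nat.card (powMonoidHom p : A →* A).ker ≤ p) : IsCyclic A := by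
  classical
  have key : ∀ n : ℕ, n ≠ 0 → Nat.card (powMonoidHom n : A →* A).ker ≤ n := by
    intro n
    induction n using Nat.recOnMul with
    | zero => simp
    | one =>
      intro _
      have : (powMonoidHom 1 : A →* A) = MonoidHom.id A := by ext; simp
      simp [this]
    | prime p hp => exact fun _ => h p hp
    | mul a b iha ihb =>
      intro hab
      have ha := iha (left_ne_zero_of_mul hab)
      have hb := ihb (right_ne_zero_of_mul hab)
      let f : (powMonoidHom (a * b) : A →* A).ker →* A := (powMonoidHom a).comp (Subgroup.subtype _)
      rw [← Subgroup.card_mul_index f.ker, Subgroup.index_ker]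
      refine Nat.mul_le_mul (le_trans ?_ ha) (le_trans ?_ hb)
      · refine Nat.card_le_card_of_injective
          (fun x => (⟨x.1.1, x.2⟩ : (powMonoidHom a : A →* A).ker)) fun x y hxy => ?_
        simpa only [Subtype.ext_iff] using hxy
      · refine Nat.card_mono (Set.toFinite _) ?_
        rintro _ ⟨x, rfl⟩
        have := x.2
        simp only [MonoidHom.mem_ker, powMonoidHom_apply] at this
        simpa [f, MonoidHom.mem_ker, ← pow_mul] using this
  have := Fintype.ofFinite A
  refine isCyclic_of_card_pow_eq_one_le fun n hn => le_trans (le_of_eq ?_) (key n hn.ne')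
  rw [Nat.card_eq_fintype_card, Fintype.card_subtype]
  simp [MonoidHom.mem_ker]

/-- Every family of `d` elements of `X` has a nonempty subfamily with sum zero; that is, `d` is
an upper bound for the Davenport constant of `X`. -/
def DavenportConstantLE (X : Type) [AddCommGroup X] (d : ℕ) : Prop :=
  ∀ f : Fin d → X, ∃ t : Finset (Fin d), t.Nonempty ∧ ∑ i ∈ t, f i = 0

theorem DavenportConstantLE.exists_subset {X : Type} [AddCommGroup X] {d : ℕ}
    (hd : DavenportConstantLE X d) {ι : Type*} (s : Finset ι) (hs : d ≤ s.card) (f : ι → X) :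
    ∃ t ⊆ s, t.Nonempty ∧ t.card ≤ d ∧ ∑ i ∈ t, f i = 0 := by
  let e : Fin d ↪ ι := (Fin.castLEEmb hs).trans (s.equivFin.symm.toEmbedding.trans
    (Function.Embedding.subtype _))
  obtain ⟨t, ht, h0⟩ := hd (f ∘ e)
  refine ⟨t.map e, ?_, by simpa using ht, ?_, by simpa using h0⟩
  · intro i hi
    obtain ⟨j, -, rfl⟩ := Finset.mem_map.mp hi
    exact (s.equivFin.symm (Fin.castLEEmb hs j)).2
  · simpa using t.card_le_univ

theorem davenportConstantLE_card (X : Type) [AddCommGroup X] [Finite X] :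
    DavenportConstantLE X (Nat.card X) := by
  intro f
  have := Fintype.ofFinite X
  let S : Fin (Nat.card X + 1) → X := fun j => ∑ i with i.castSucc < j, f i
  obtain ⟨a, b, hab, hS⟩ : ∃ a b, a < b ∧ S a = S b := by
    obtain ⟨a, b, hne, h⟩ := Fintype.exists_ne_map_eq_of_card_lt S (by simp)
    rcases lt_or_gt_of_ne hne with hlt | hlt
    exacts [⟨a, b, hlt, h⟩, ⟨b, a, hlt, h.symm⟩]
  refine ⟨(Finset.univ.filter fun i : Fin (Nat.card X) => i.castSucc < b) \
    Finset.univ.filter fun i => i.castSucc < a, ⟨a.castLT (by omega), by simpa using hab⟩, ?_⟩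
  rw [Finset.sum_sdiff_eq_sub, sub_eq_zero]
  · exact hS.symm
  · intro i
    simpa using fun h => h.trans hab

theorem davenportConstantLE_zmodModule (p : ℕ) [Fact p.Prime] (X : Type) [AddCommGroup X]
    [Module (ZMod p) X] [Module.Finite (ZMod p) X] :
    DavenportConstantLE X (1 + Module.finrank (ZMod p) X * (p - 1)) := by
  set k := Module.finrank (ZMod p) X
  set d := 1 + k * (p - 1)
  intro f
  let b := Module.finBasis (ZMod p) X
  let F : Fin k → MvPolynomial (Fin d) (ZMod p) := fun j =>
    ∑ i, MvPolynomial.C (b.repr (f i) j) * MvPolynomial.X i ^ (p - 1)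
  have hp : p - 1 ≠ 0 := Nat.sub_ne_zero_of_lt (Fact.out : p.Prime).one_lt
  have hF : ∑ j, (F j).totalDegree < Fintype.card (Fin d) := by
    have h₁ (j : Fin k) : (F j).totalDegree ≤ p - 1 := by
      refine MvPolynomial.totalDegree_finsetSum_le fun i _ => ?_
      refine (MvPolynomial.totalDegree_mul _ _).trans ?_
      simp
    calc _ ≤ ∑ _j : Fin k, (p - 1) := Finset.sum_le_sum fun j _ => h₁ j
      _ < _ := by simp [d]
  have hdvd : p ∣ Nat.card {x : Fin d → ZMod p // ∀ j, MvPolynomial.eval x (F j) = 0} := by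
    rw [Nat.card_eq_fintype_card]
    convert! char_dvd_card_solutions_of_fintype_sum_lt p hF
  have h0 : ∀ j, MvPolynomial.eval (0 : Fin d → ZMod p) (F j) = 0 := fun j => by
    simp [F, hp]
  have hone : 1 < Nat.card {x : Fin d → ZMod p // ∀ j, MvPolynomial.eval x (F j) = 0} :=
    (Fact.out : p.Prime).one_lt.trans_le
      (Nat.le_of_dvd (Nat.card_pos_iff.mpr ⟨⟨⟨0, h0⟩⟩, inferInstance⟩) hdvd)
  rw [Finite.one_lt_card_iff_nontrivial] at hone
  obtain ⟨⟨x, hx⟩, hne⟩ :=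
    exists_ne (⟨0, h0⟩ : {x : Fin d → ZMod p // ∀ j, MvPolynomial.eval x (F j) = 0})
  refine ⟨Finset.univ.filter fun i => x i ≠ 0, ?_, ?_⟩
  · obtain ⟨i, hi⟩ := Function.ne_iff.mp fun h => hne (Subtype.ext h)
    exact ⟨i, by simpa using hi⟩
  · refine b.repr.injective (Finsupp.ext fun j => ?_)
    have := hx j
    simp only [F, map_sum, map_mul, MvPolynomial.eval_C, map_pow, MvPolynomial.eval_X] at this
    rw [map_sum, Finsupp.finsetSum_apply, Finset.sum_filter, map_zero, Finsupp.zero_apply]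
    refine Eq.trans (Finset.sum_congr rfl fun i _ => ?_) this
    split_ifs with h
    · rw [ZMod.pow_card_sub_one_eq_one h, mul_one]
    · rw [not_not.mp h, zero_pow hp, mul_zero]

theorem davenportConstantLE_of_natCard_eq {p k : ℕ} [Fact p.Prime] {X : Type} [AddCommGroup X]
    [Finite X] [Module (ZMod p) X] (hcard : Nat.card X = p ^ k) :
    DavenportConstantLE X (1 + k * (p - 1)) := by
  have hk : Module.finrank (ZMod p) X = k := by
    rw [Module.natCard_eq_pow_finrank (K := ZMod p), Nat.card_zmod] at hcard
    exact Nat.pow_right_injective (Fact.out : p.Prime).two_le hcard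
  exact hk ▸ davenportConstantLE_zmodModule p X

theorem davenportConstantLE_of_nsmul_eq_zero {p k : ℕ} [Fact p.Prime] {X : Type} [AddCommGroup X]
    [Finite X] (hexp : ∀ x : X, p • x = 0) (hcard : Nat.card X = p ^ k) :
    DavenportConstantLE X (1 + k * (p - 1)) := by
  have : Module (ZMod p) X := AddCommGroup.zmodModule hexp
  exact davenportConstantLE_of_natCard_eq hcard

/-- `d` is a uniform degree bound for the invariants of `G`: for every action of `G` on a
commutative `ℂ`-algebra and every `G`-stable subspace `V`, the invariants in the subalgebra
generated by `V` are generated by the invariants that are polynomials of degree at most `d` in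
elements of `V`. -/
def HasNoetherBound (G : Type) [Group G] (d : ℕ) : Prop :=
  ∀ (R : Type) [CommRing R] [Algebra ℂ R] (φ : G →* (R →ₐ[ℂ] R)) (V : Submodule ℂ R),
    (∀ g, ∀ v ∈ V, φ g v ∈ V) → ∀ f ∈ Algebra.adjoin ℂ (V : Set R), (∀ g, φ g f = f) →
      f ∈ Algebra.adjoin ℂ {h : R | h ∈ (1 ⊔ V) ^ d ∧ ∀ g, φ g h = h}

theorem apply_mem_one_sup_pow {R : Type} [CommRing R] [Algebra ℂ R] (φ : R →ₐ[ℂ] R)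
    {V : Submodule ℂ R} (hV : ∀ v ∈ V, φ v ∈ V) (n : ℕ) {x : R} (hx : x ∈ (1 ⊔ V) ^ n) :
    φ x ∈ (1 ⊔ V) ^ n := by
  have h₁ : Submodule.map φ.toLinearMap (1 ⊔ V) ≤ 1 ⊔ V := by
    rw [Submodule.map_sup, Submodule.map_one]
    exact sup_le_sup_left (Submodule.map_le_iff_le_comap.mpr hV) _
  have h₂ := Submodule.mem_map_of_mem (f := φ.toLinearMap) hx
  rw [Submodule.map_pow] at h₂
  exact pow_le_pow_left' h₁ n h₂

/-- The fixed points of a subgroup. -/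
def fixedSubalgebra {G R : Type} [Group G] [CommRing R] [Algebra ℂ R] (φ : G →* (R →ₐ[ℂ] R))
    (N : Subgroup G) : Subalgebra ℂ R :=
  ⨅ g : N, AlgHom.equalizer (φ g) (AlgHom.id ℂ R)

theorem mem_fixedSubalgebra {G R : Type} [Group G] [CommRing R] [Algebra ℂ R]
    {φ : G →* (R →ₐ[ℂ] R)} {N : Subgroup G} {x : R} :
    x ∈ fixedSubalgebra φ N ↔ ∀ g ∈ N, φ g x = x := by
  simp [fixedSubalgebra, Algebra.mem_iInf]

theorem map_mem_fixedSubalgebra {G R : Type} [Group G] [CommRing R] [Algebra ℂ R]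
    (φ : G →* (R →ₐ[ℂ] R)) (N : Subgroup G) [hN : N.Normal] (g : G) {x : R}
    (hx : x ∈ fixedSubalgebra φ N) : φ g x ∈ fixedSubalgebra φ N := by
  rw [mem_fixedSubalgebra] at hx ⊢
  intro n hn
  have h₁ := hx _ (hN.conj_mem n hn g⁻¹)
  calc φ n (φ g x) = φ (g * (g⁻¹ * n * g⁻¹⁻¹)) x := by
        rw [← AlgHom.mul_apply, ← map_mul]; congr 2; group
    _ = φ g x := by rw [map_mul, AlgHom.mul_apply, h₁]

/-- The action of `G ⧸ N` on the fixed points of `N`. -/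
def quotientAction {G R : Type} [Group G] [CommRing R] [Algebra ℂ R] (φ : G →* (R →ₐ[ℂ] R))
    (N : Subgroup G) [N.Normal] :
    G ⧸ N →* (fixedSubalgebra φ N →ₐ[ℂ] fixedSubalgebra φ N) :=
  QuotientGroup.lift N
    { toFun := fun g => ((φ g).comp (fixedSubalgebra φ N).val).codRestrict (fixedSubalgebra φ N)
        fun x => map_mem_fixedSubalgebra φ N g x.2
      map_one' := by ext; simp
      map_mul' := fun g h => AlgHom.ext fun x => Subtype.ext <|
        DFunLike.congr_fun (map_mul φ g h) (x : R) }
    fun n hn => AlgHom.ext fun x => Subtype.ext (mem_fixedSubalgebra.mp x.2 n hn)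

theorem coe_quotientAction_mk {G R : Type} [Group G] [CommRing R] [Algebra ℂ R]
    (φ : G →* (R →ₐ[ℂ] R)) (N : Subgroup G) [N.Normal] (g : G) (x : fixedSubalgebra φ N) :
    (quotientAction φ N (QuotientGroup.mk g) x : R) = φ g x := rfl

theorem HasNoetherBound.mul {G : Type} [Group G] {N : Subgroup G} [N.Normal] {a b : ℕ}
    (hN : HasNoetherBound N b) (hQ : HasNoetherBound (G ⧸ N) a) : HasNoetherBound G (b * a) := by
  intro R _ _ φ V hV f hf hfix
  set S := fixedSubalgebra φ N
  have hone : (1 : Submodule ℂ R) ≤ (1 ⊔ V) ^ b := by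
    simpa using pow_le_pow_left' (le_sup_left (a := (1 : Submodule ℂ R)) (b := V)) b
  let W : Submodule ℂ S := ((1 ⊔ V) ^ b).comap S.val.toLinearMap
  have hW : ∀ g, ∀ w ∈ W, quotientAction φ N g w ∈ W := by
    intro g w hw
    induction g using QuotientGroup.induction_on with
    | H g => exact apply_mem_one_sup_pow (φ g) (hV g) b hw
  have hfN := hN R (φ.comp N.subtype) V (fun g => hV g) f hf fun g => hfix g
  have hfS : f ∈ S := mem_fixedSubalgebra.mpr fun g _ => hfix g
  have hfW : (⟨f, hfS⟩ : S) ∈ Algebra.adjoin ℂ (W : Set S) := by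
    have himg : {h : R | h ∈ (1 ⊔ V) ^ b ∧ ∀ g, (φ.comp N.subtype) g h = h} = S.val '' W := by
      ext h
      constructor
      · rintro ⟨h₁, h₂⟩
        exact ⟨⟨h, mem_fixedSubalgebra.mpr fun g hg => h₂ ⟨g, hg⟩⟩, h₁, rfl⟩
      · rintro ⟨w, hw, rfl⟩
        exact ⟨hw, fun g => mem_fixedSubalgebra.mp w.2 g g.2⟩
    rw [himg, ← AlgHom.map_adjoin] at hfN
    obtain ⟨y, hy, hyf⟩ := hfN
    rwa [show (⟨f, hfS⟩ : S) = y from Subtype.ext hyf.symm]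
  have key := hQ S (quotientAction φ N) W hW ⟨f, hfS⟩ hfW fun g => by
    induction g using QuotientGroup.induction_on with
    | H g => exact Subtype.ext (hfix g)
  have key' : f ∈ (Algebra.adjoin ℂ _).map S.val := ⟨_, key, rfl⟩
  rw [AlgHom.map_adjoin] at key'
  refine Algebra.adjoin_mono ?_ key'
  rintro _ ⟨h, ⟨h₁, h₂⟩, rfl⟩
  refine ⟨?_, fun g => congrArg Subtype.val (h₂ (QuotientGroup.mk g))⟩
  have hle : Submodule.map S.val.toLinearMap (1 ⊔ W) ≤ (1 ⊔ V) ^ b := by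
    rw [Submodule.map_sup, Submodule.map_one]
    exact sup_le hone (Submodule.map_comap_le _ _)
  have := Submodule.mem_map_of_mem (f := S.val.toLinearMap) h₁
  rw [Submodule.map_pow] at this
  rw [pow_mul]
  exact pow_le_pow_left' hle a this

theorem prod_mem_adjoin_of_davenportConstantLE {X R : Type} [AddCommGroup X] [CommRing R]
    [Algebra ℂ R] {d : ℕ} (hd : DavenportConstantLE X d) {A : Set R} {ι : Type*} (χ : ι → X)
    (v : ι → R)
    (hA : ∀ t : Finset ι, t.card ≤ d → ∑ i ∈ t, χ i = 0 → ∏ i ∈ t, v i ∈ A)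
    (s : Finset ι) (hs : ∑ i ∈ s, χ i = 0) : ∏ i ∈ s, v i ∈ Algebra.adjoin ℂ A := by
  classical
  induction s using Finset.strongInduction with
  | H s ih =>
    rcases le_total s.card d with hsd | hsd
    · exact Algebra.subset_adjoin (hA s hsd hs)
    · obtain ⟨t, hts, hne, htd, ht0⟩ := hd.exists_subset s hsd χ
      rw [← Finset.prod_sdiff hts]
      refine mul_mem (ih _ (Finset.sdiff_ssubset hts hne) ?_) (Algebra.subset_adjoin (hA t htd ht0))
      rwa [← Finset.sum_sdiff hts, ht0, add_zero] at hs

theorem prod_mem_pow_card {R ι : Type*} [CommRing R] [Algebra ℂ R] {M : Submodule ℂ R}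
    {v : ι → R} (s : Finset ι) (hv : ∀ i ∈ s, v i ∈ M) : ∏ i ∈ s, v i ∈ M ^ s.card := by
  classical
  induction s using Finset.induction_on with
  | empty => simp [Submodule.one_le.mp le_rfl]
  | insert i s hi ih =>
    rw [Finset.prod_insert hi, Finset.card_insert_of_notMem hi, pow_succ']
    exact Submodule.mul_mem_mul (hv i (Finset.mem_insert_self i s))
      (ih fun j hj => hv j (Finset.mem_insert_of_mem hj))

theorem hasNoetherBound_of_davenportConstantLE {G : Type} [CommGroup G] [Finite G] {d : ℕ}
    (hd : DavenportConstantLE (AddChar (Additive G) ℂ) d) : HasNoetherBound G d := by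
  classical
  intro R _ _ φ V hV f hf hfix
  have := Fintype.ofFinite G
  set A : Set R := {h : R | h ∈ (1 ⊔ V) ^ d ∧ ∀ g, φ g h = h}
  let IsWeight (ψ : AddChar (Additive G) ℂ) (v : R) : Prop :=
    ∀ g, φ g v = ψ (Additive.ofMul g) • v
  let W : Set R := {v | v ∈ V ∧ ∃ ψ, IsWeight ψ v}
  have hcard : (Fintype.card G : ℂ) ≠ 0 := by simp
  have hVW : (V : Set R) ⊆ Submodule.span ℂ W := by
    intro v hv
    let e (ψ : AddChar (Additive G) ℂ) : R := ∑ g : G, ψ (Additive.ofMul g⁻¹) • φ g v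
    have he (ψ) : e ψ ∈ W := by
      refine ⟨V.sum_mem fun g _ => V.smul_mem _ (hV g v hv), ψ, fun h => ?_⟩
      simp only [e, map_sum, map_smul, Finset.smul_sum, smul_smul]
      refine Fintype.sum_equiv (Equiv.mulLeft h) _ _ fun g => ?_
      simp [← AddChar.map_add_eq_mul]
    have hsum : ∑ ψ, e ψ = (Fintype.card G : ℂ) • v := by
      simp only [e]
      rw [Finset.sum_comm]
      simp only [← Finset.sum_smul, AddChar.sum_apply_eq_ite]
      simp
    have : v = (Fintype.card G : ℂ)⁻¹ • ∑ ψ, e ψ := by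
      rw [hsum, smul_smul, inv_mul_cancel₀ hcard, one_smul]
    rw [this]
    exact Submodule.smul_mem _ _ (Submodule.sum_mem _ fun ψ _ => Submodule.subset_span (he ψ))
  have hmono : ∀ m ∈ Submonoid.closure W, ∑ g : G, φ g m ∈ Algebra.adjoin ℂ A := by
    intro m hm
    obtain ⟨l, hl, rfl⟩ := Submonoid.exists_list_of_mem_closure hm
    choose hlV χ hχ using fun i : Fin l.length => hl _ (l.get_mem i)
    have hprod : l.prod = ∏ i, l.get i := by rw [← List.prod_ofFn, List.ofFn_get]
    have hweight (t : Finset (Fin l.length)) (g : G) : φ g (∏ i ∈ t, l.get i) =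
        (∑ i ∈ t, χ i) (Additive.ofMul g) • ∏ i ∈ t, l.get i := by
      rw [map_prod, Finset.prod_congr rfl fun i _ => hχ i g, Finset.prod_smul,
        AddChar.sum_apply]
    rw [hprod]
    simp only [hweight, ← Finset.sum_smul]
    by_cases h0 : ∑ i, χ i = 0
    · refine Subalgebra.smul_mem _ ?_ _
      refine prod_mem_adjoin_of_davenportConstantLE hd (A := A) χ _
        (fun t ht ht0 => ⟨?_, fun g => ?_⟩) _ h0
      · exact pow_le_pow_right' (le_sup_left : (1 : Submodule ℂ R) ≤ 1 ⊔ V) ht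
          (prod_mem_pow_card t fun i _ => Submodule.mem_sup_right (hlV i))
      · rw [hweight, ht0, AddChar.zero_apply, one_smul]
    · have hsum : ∑ g : G, (∑ i, χ i) (Additive.ofMul g) = 0 :=
        (Equiv.sum_comp Additive.ofMul _).trans (AddChar.sum_eq_zero_of_ne_one h0)
      rw [hsum, zero_smul]
      exact zero_mem _
  have hfW : f ∈ Submodule.span ℂ (Submonoid.closure W : Set R) := by
    rw [← Algebra.adjoin_eq_span]
    exact Algebra.adjoin_le (hVW.trans (Algebra.span_le_adjoin ℂ W)) hf
  have hT : (∑ g : G, (φ g).toLinearMap) f ∈ Algebra.adjoin ℂ A := by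
    rw [← Subalgebra.mem_toSubmodule, ← Submodule.mem_comap]
    refine Submodule.span_le.mpr (fun m hm => ?_) hfW
    simpa using hmono m hm
  have hf' : f = (Fintype.card G : ℂ)⁻¹ • (∑ g : G, (φ g).toLinearMap) f := by
    simp [hfix, ← Nat.cast_smul_eq_nsmul ℂ, smul_smul]
  rw [hf']
  exact Subalgebra.smul_mem _ hT _

theorem hasNoetherBound_card {G : Type} [CommGroup G] [Finite G] :
    HasNoetherBound G (Nat.card G) := by
  have := Fintype.ofFinite G
  have h := davenportConstantLE_card (AddChar (Additive G) ℂ)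
  rw [Nat.card_eq_fintype_card, AddChar.card_eq, ← Nat.card_eq_fintype_card] at h
  exact hasNoetherBound_of_davenportConstantLE h

theorem hasNoetherBound_of_pow_eq_one {G : Type} [CommGroup G] [Finite G] {p k : ℕ}
    [Fact p.Prime] (hexp : ∀ g : G, g ^ p = 1) (hcard : Nat.card G = p ^ k) :
    HasNoetherBound G (1 + k * (p - 1)) := by
  have := Fintype.ofFinite G
  refine hasNoetherBound_of_davenportConstantLE
    (davenportConstantLE_of_nsmul_eq_zero (fun ψ => DFunLike.ext _ _ fun a => ?_) ?_)
  · rw [AddChar.nsmul_apply, ← AddChar.map_nsmul_eq_pow, AddChar.zero_apply,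
      show p • a = 0 from hexp a.toMul, AddChar.map_zero_eq_one]
  · rw [Nat.card_eq_fintype_card, AddChar.card_eq, ← hcard]
    exact Nat.card_eq_fintype_card.symm

/-- The subgroup generated by commutators and `n`-th powers. -/
def commutatorPow (G : Type*) [Group G] (n : ℕ) : Subgroup G :=
  (powMonoidHom n : Abelianization G →* Abelianization G).range.comap Abelianization.of

theorem mem_commutatorPow {G : Type*} [Group G] {n : ℕ} {x : G} :
    x ∈ commutatorPow G n ↔ ∃ y : G, Abelianization.of y ^ n = Abelianization.of x := by
  refine ⟨fun ⟨y, hy⟩ => ?_, fun ⟨y, hy⟩ => ⟨_, hy⟩⟩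
  obtain ⟨y, rfl⟩ := QuotientGroup.mk_surjective y
  exact ⟨y, hy⟩

instance characteristic_commutatorPow (G : Type*) [Group G] (n : ℕ) :
    (commutatorPow G n).Characteristic := by
  rw [Subgroup.characteristic_iff_le_comap]
  intro σ x hx
  obtain ⟨y, hy⟩ := mem_commutatorPow.mp hx
  refine mem_commutatorPow.mpr ⟨σ y, ?_⟩
  simpa using congrArg (Abelianization.map σ.toMonoidHom) hy

theorem index_commutatorPow (G : Type*) [Group G] [Finite G] (n : ℕ) :
    (commutatorPow G n).index =
      Nat.card (powMonoidHom n : Abelianization G →* Abelianization G).ker := by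
  rw [commutatorPow, Subgroup.index_comap_of_surjective _ QuotientGroup.mk_surjective]
  have h₁ := (powMonoidHom n : Abelianization G →* Abelianization G).range.card_mul_index
  have h₂ := (powMonoidHom n : Abelianization G →* Abelianization G).ker.card_mul_index
  rw [Subgroup.index_ker, mul_comm] at h₂
  exact Nat.eq_of_mul_eq_mul_left Nat.card_pos (h₁.trans h₂.symm)

theorem hasNoetherBound_quotient_commutatorPow (G : Type) [Group G] [Finite G] {p k : ℕ}
    [Fact p.Prime] (hk : (commutatorPow G p).index = p ^ k) :
    HasNoetherBound (G ⧸ commutatorPow G p) (1 + k * (p - 1)) := by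
  let : CommGroup (G ⧸ commutatorPow G p) :=
    { (inferInstance : Group (G ⧸ commutatorPow G p)) with
      mul_comm := by
        rintro ⟨x⟩ ⟨y⟩
        exact QuotientGroup.eq.mpr (mem_commutatorPow.mpr ⟨1, by
          rw [map_one, one_pow, map_mul, map_inv, map_mul, map_mul,
            mul_comm (Abelianization.of y), inv_mul_cancel]⟩) }
  refine hasNoetherBound_of_pow_eq_one ?_ hk
  rintro ⟨x⟩
  exact (QuotientGroup.eq_one_iff (x ^ p)).mpr (mem_commutatorPow.mpr ⟨x, by simp⟩)

theorem exists_prime_index_commutatorPow (G : Type*) [Group G] [Finite G] [Group.IsNilpotent G]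
    (hG : ¬ IsCyclic G) :
    ∃ p k : ℕ, p.Prime ∧ 2 ≤ k ∧ (commutatorPow G p).index = p ^ k := by
  have hA : ¬ IsCyclic (Abelianization G) := fun _ =>
    hG (isCyclic_of_isCyclic_abelianization G)
  obtain ⟨p, hp, hlt⟩ : ∃ p : ℕ, p.Prime ∧
      p < Nat.card (powMonoidHom p : Abelianization G →* Abelianization G).ker := by
    by_contra! h
    exact hA (isCyclic_of_forall_prime_card_ker_pow_le _ h)
  have := Fact.mk hp
  have hP : IsPGroup p (powMonoidHom p : Abelianization G →* Abelianization G).ker :=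
    fun x => ⟨1, Subtype.ext (by simpa using MonoidHom.mem_ker.mp x.2)⟩
  obtain ⟨k, hk⟩ := IsPGroup.iff_card.mp hP
  refine ⟨p, k, hp, ?_, (index_commutatorPow G p).trans hk⟩
  rw [hk] at hlt
  exact (Nat.pow_lt_pow_iff_right hp.one_lt).mp (by simpa using hlt)

theorem exists_characteristic_isCyclic_hasNoetherBound (G : Type) [Group G] [Finite G]
    [hnil : Group.IsNilpotent G] :
    ∃ D : Subgroup G, D.Characteristic ∧ IsCyclic D ∧
      ∃ d, HasNoetherBound G d ∧ d ^ 5 ≤ Nat.card D * Nat.card G ^ 4 := by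
  induction hn : Nat.card G using Nat.strong_induction_on generalizing G with
  | _ n ih =>
    subst hn
    by_cases hG : IsCyclic G
    · let : CommGroup G := IsCyclic.commGroup
      exact ⟨⊤, inferInstance, inferInstance, Nat.card G, hasNoetherBound_card, by
        rw [Subgroup.card_top, ← pow_succ']⟩
    · obtain ⟨p, k, hp, hk, hidx⟩ := exists_prime_index_commutatorPow G hG
      have := Fact.mk hp
      set N := commutatorPow G p
      have hcard : Nat.card N * p ^ k = Nat.card G := hidx ▸ N.card_mul_index
      have hlt : Nat.card N < Nat.card G := by
        rw [← hcard]
        exact lt_mul_of_one_lt_right Nat.card_pos (Nat.one_lt_pow (by omega) hp.one_lt)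
      obtain ⟨D, hD, hDc, d, hd, hle⟩ := ih _ hlt N rfl
      refine ⟨D.map N.subtype, inferInstance,
        (D.equivMapOfInjective N.subtype N.subtype_injective).isCyclic.mp hDc, _,
        hd.mul (hasNoetherBound_quotient_commutatorPow G hidx), ?_⟩
      rw [Subgroup.card_map_of_injective N.subtype_injective, ← hcard, mul_pow, mul_pow,
        ← mul_assoc]
      exact Nat.mul_le_mul hle (one_add_mul_pow_five_le hp.two_le hk)

/-- The action of a representation on polynomial functions. -/
noncomputable def Representation.polyAction {G : Type} [Group G] {n : ℕ}
    (ρ : Representation ℂ G (Fin n → ℂ)) :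
    G →* (MvPolynomial (Fin n) ℂ →ₐ[ℂ] MvPolynomial (Fin n) ℂ) where
  toFun g := ρ.polySubst g⁻¹
  map_one' := by
    refine MvPolynomial.algHom_ext fun i => ?_
    simp [Representation.polySubst, Pi.single_apply]
  map_mul' g h := by
    refine MvPolynomial.algHom_ext fun i => ?_
    simp only [Representation.polySubst, mul_inv_rev, map_mul, LinearMap.toMatrix'_mul,
      Matrix.mul_apply, AlgHom.mul_apply, MvPolynomial.aeval_X, map_sum, MvPolynomial.algHom_C,
      MvPolynomial.algebraMap_eq, Finset.sum_mul, Finset.mul_sum]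
    rw [Finset.sum_comm]
    simp only [mul_assoc]

theorem Representation.mem_invariantAlgebra_s9 {G : Type} [Group G] {n : ℕ}
    {ρ : Representation ℂ G (Fin n → ℂ)} {f : MvPolynomial (Fin n) ℂ} :
    f ∈ ρ.invariantAlgebra ↔ ∀ g, ρ.polyAction g f = f := by
  simp only [Representation.invariantAlgebra, Algebra.mem_iInf, AlgHom.mem_equalizer]
  exact ⟨fun h g => h g⁻¹, fun h g => by simpa [Representation.polyAction] using h g⁻¹⟩

theorem HasNoetherBound.noetherNumber_le {G : Type} [Group G] {d : ℕ} (hd : HasNoetherBound G d) :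
    noetherNumber G ≤ d := by
  refine Nat.sInf_le fun n ρ => le_antisymm (Algebra.adjoin_le fun f hf => hf.1) fun f hf => ?_
  let V : Submodule ℂ (MvPolynomial (Fin n) ℂ) := Submodule.span ℂ (Set.range MvPolynomial.X)
  have hV : ∀ g, ∀ v ∈ V, ρ.polyAction g v ∈ V := by
    intro g v hv
    refine Submodule.span_le (p := V.comap (ρ.polyAction g).toLinearMap).mpr ?_ hv
    rintro _ ⟨i, rfl⟩
    simp only [Submodule.comap_coe, Set.mem_preimage, AlgHom.toLinearMap_apply, SetLike.mem_coe,
      Representation.polyAction, MonoidHom.coe_mk, OneHom.coe_mk, Representation.polySubst,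
      MvPolynomial.aeval_X, ← MvPolynomial.smul_eq_C_mul]
    exact V.sum_mem fun j _ => V.smul_mem _ (Submodule.subset_span ⟨j, rfl⟩)
  have hfV : f ∈ Algebra.adjoin ℂ (V : Set (MvPolynomial (Fin n) ℂ)) := by
    refine Algebra.adjoin_mono Submodule.subset_span ?_
    rw [MvPolynomial.adjoin_range_X]
    exact Algebra.mem_top
  have hdeg : (1 ⊔ V) ^ d ≤ MvPolynomial.restrictTotalDegree (Fin n) ℂ d := by
    generalize d = m
    induction m with
    | zero => simp [Submodule.one_le, MvPolynomial.mem_restrictTotalDegree]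
    | succ m ih =>
      have hle : 1 ⊔ V ≤ MvPolynomial.restrictTotalDegree (Fin n) ℂ 1 := by
        refine sup_le (Submodule.one_le.mpr ?_) (Submodule.span_le.mpr ?_)
        · simp [MvPolynomial.mem_restrictTotalDegree]
        · rintro _ ⟨i, rfl⟩
          simp [MvPolynomial.mem_restrictTotalDegree]
      rw [pow_succ, Submodule.mul_le]
      intro x hx y hy
      have hx' := (MvPolynomial.mem_restrictTotalDegree _ _ _).mp (ih hx)
      have hy' := (MvPolynomial.mem_restrictTotalDegree _ _ _).mp (hle hy)
      rw [MvPolynomial.mem_restrictTotalDegree]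
      exact (MvPolynomial.totalDegree_mul x y).trans (Nat.add_le_add hx' hy')
  refine Algebra.adjoin_mono (fun h hh => ?_)
    (hd _ ρ.polyAction V hV f hfV (Representation.mem_invariantAlgebra_s9.mp hf))
  exact ⟨Representation.mem_invariantAlgebra_s9.mpr hh.2,
    (MvPolynomial.mem_restrictTotalDegree _ _ _).mp (hdeg hh.1)⟩

/-- **Proposition (nilpotent groups).**  If `C` is a characteristic cyclic subgroup
of maximal order in a finite nilpotent group `G`, then `β(G) ≤ |C|^0.2 · |G|^0.8`. -/
theorem noetherNumber_le_of_nilpotent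
    (G : Type) [Group G] [Finite G] (hnil : Group.IsNilpotent G)
    (C : Subgroup G) (hchar : C.Characteristic) (hcyc : IsCyclic ↥C)
    (hmax : ∀ D : Subgroup G, D.Characteristic → IsCyclic ↥D →
      Nat.card D ≤ Nat.card C) :
    (noetherNumber G : ℝ) ≤
      (Nat.card C : ℝ) ^ (0.2 : ℝ) * (Nat.card G : ℝ) ^ (0.8 : ℝ) := by
  obtain ⟨D, hD, hDc, d, hd, hle⟩ := exists_characteristic_isCyclic_hasNoetherBound G
  have hd5 : (noetherNumber G : ℝ) ^ 5 ≤ Nat.card C * (Nat.card G : ℝ) ^ 4 := by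
    have := (Nat.pow_le_pow_left hd.noetherNumber_le 5).trans
      (hle.trans (Nat.mul_le_mul_right _ (hmax D hD hDc)))
    exact_mod_cast this
  refine le_of_pow_le_pow_left₀ (n := 5) (by norm_num) (by positivity) (hd5.trans_eq ?_)
  rw [mul_pow, ← Real.rpow_mul_natCast (by positivity), ← Real.rpow_mul_natCast (by positivity)]
  norm_num
end
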